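/- arXiv:cs/0507018 — 3 statements merged into one kernel-verified Lean document; each statement's English description precedes it below -/
import Mathlib

section
/- Let Y be a centered Gaussian random vector in ℝⁿ with covariance matrix Σ, let W be a symmetric real n×n matrix, and let λ₁,…,λₙ be the eigenvalues of WΣ. Then for every real number t with max_i t·λ_i ≥ 1/2, one has E[exp(t·YᵀWY)] = +∞. -/
open MeasureTheory Matrix ProbabilityTheory

/-- The centered multivariate Gaussian measure `N(0, A * Aᵀ)` on `ℝⁿ`, realized as the law of
`A ⬝ Z` for a standard Gaussian vector `Z` (a vector of i.i.d. `N(0,1)` entries).  Every centered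
Gaussian measure with positive semidefinite covariance `Σ` arises this way from any `A` with
`A * Aᵀ = Σ`. -/
noncomputable def multivariateGaussianOf {n : ℕ} (A : Matrix (Fin n) (Fin n) ℝ) :
    Measure (Fin n → ℝ) :=
  Measure.map A.mulVec (Measure.pi fun _ : Fin n => gaussianReal 0 1)

/-- A nowhere vanishing function that does not decrease along the translations by a vector `v`
transverse to a half-space has infinite integral. -/
theorem lintegral_eq_top_of_le_add_nsmul {E : Type*} [NormedAddCommGroup E] [NormedSpace ℝ E]
    [MeasurableSpace E] [BorelSpace E] (μ : Measure E) [μ.IsAddRightInvariant]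
    [μ.IsOpenPosMeasure] {f : E → ENNReal} (hf : Measurable f) (hf0 : ∀ z, f z ≠ 0)
    (L : E →L[ℝ] ℝ) (v : E) (hv : L v = 1)
    (hle : ∀ z, 0 < L z → ∀ k : ℕ, f z ≤ f (z + k • v)) :
    ∫⁻ z, f z ∂μ = ⊤ := by
  let S : ℕ → Set E := fun k => L ⁻¹' Set.Ioo (k : ℝ) (k + 1)
  have hSo (k : ℕ) : IsOpen (S k) := isOpen_Ioo.preimage L.continuous
  have hpos : ∫⁻ z in S 0, f z ∂μ ≠ 0 := by
    rw [← pos_iff_ne_zero, setLIntegral_pos_iff hf]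
    have hsupp : Function.support f = Set.univ := Set.eq_univ_of_forall hf0
    rw [hsupp, Set.univ_inter]
    refine (hSo 0).measure_pos μ ⟨(1 / 2 : ℝ) • v, ?_⟩
    simp only [S, Set.mem_preimage, map_smul, hv, smul_eq_mul, Set.mem_Ioo]
    norm_num
  have hstep (k : ℕ) : ∫⁻ z in S 0, f z ∂μ ≤ ∫⁻ z in S k, f z ∂μ := by
    rw [← lintegral_indicator (hSo 0).measurableSet, ← lintegral_indicator (hSo k).measurableSet,
      ← lintegral_add_right_eq_self ((S k).indicator f) (k • v)]
    refine lintegral_mono fun z => ?_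
    by_cases hz : z ∈ S 0
    · have hz' : z + k • v ∈ S k := by
        simp only [S, Set.mem_preimage, Set.mem_Ioo, Nat.cast_zero, map_add, map_nsmul, hv,
          nsmul_eq_mul, mul_one] at hz ⊢
        constructor <;> linarith [hz.1, hz.2]
      simp only [Set.indicator_of_mem hz, Set.indicator_of_mem hz']
      exact hle z (by simpa [S] using hz.1) k
    · simp only [Set.indicator_of_notMem hz, zero_le]
  have hdisj : Pairwise (Function.onFun Disjoint S) := by
    intro i j hij
    refine Set.disjoint_left.mpr fun z hi hj => hij ?_
    have h1 : (i : ℝ) < j + 1 := hi.1.trans hj.2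
    have h2 : (j : ℝ) < i + 1 := hj.1.trans hi.2
    norm_cast at h1 h2
    omega
  refine top_unique ?_
  calc ⊤ = ∑' _ : ℕ, ∫⁻ z in S 0, f z ∂μ := (ENNReal.tsum_const_eq_top_of_ne_zero hpos).symm
    _ ≤ ∑' k, ∫⁻ z in S k, f z ∂μ := ENNReal.tsum_le_tsum hstep
    _ = ∫⁻ z in ⋃ k, S k, f z ∂μ :=
      (lintegral_iUnion (fun k => (hSo k).measurableSet) hdisj f).symm
    _ ≤ ∫⁻ z, f z ∂μ := setLIntegral_le_lintegral _ _

/-- The exponential of a quadratic form with a nonnegative eigenvalue is not Lebesgue integrable. -/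
theorem lintegral_exp_quadratic_form_eq_top {ι : Type*} [Fintype ι] {N : Matrix ι ι ℝ}
    (hN : N.IsSymm) {u : ι → ℝ} (hu : u ≠ 0) {ν : ℝ} (hν : 0 ≤ ν) (hNu : N *ᵥ u = ν • u) :
    ∫⁻ z : ι → ℝ, ENNReal.ofReal (Real.exp (z ⬝ᵥ N *ᵥ z)) = ⊤ := by
  have huu : 0 < u ⬝ᵥ u := lt_of_le_of_ne (by simpa using dotProduct_star_self_nonneg u)
    (fun h => hu (dotProduct_self_eq_zero.mp h.symm))
  let L : (ι → ℝ) →L[ℝ] ℝ :=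
    LinearMap.toContinuousLinearMap ((u ⬝ᵥ u)⁻¹ • dotProductBilin ℝ ℝ u)
  have hL (z : ι → ℝ) : L z = (u ⬝ᵥ u)⁻¹ * (u ⬝ᵥ z) := rfl
  have hmeas : Continuous fun z : ι → ℝ => z ⬝ᵥ N *ᵥ z := by fun_prop
  refine lintegral_eq_top_of_le_add_nsmul volume (by fun_prop)
    (fun z => (ENNReal.ofReal_pos.mpr (Real.exp_pos _)).ne') L u
    (by rw [hL, inv_mul_cancel₀ huu.ne']) fun z hz k => ?_
  refine ENNReal.ofReal_le_ofReal (Real.exp_le_exp.mpr ?_)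
  have hz' : 0 < u ⬝ᵥ z := by
    rw [hL] at hz
    exact pos_of_mul_pos_right hz (inv_pos.mpr huu).le
  have hsymm : u ⬝ᵥ N *ᵥ z = ν * (u ⬝ᵥ z) := by
    rw [dotProduct_mulVec, ← mulVec_transpose, hN.eq, hNu, smul_dotProduct, smul_eq_mul]
  have hexp : (z + k • u) ⬝ᵥ N *ᵥ (z + k • u)
      = z ⬝ᵥ N *ᵥ z + ν * (2 * k * (u ⬝ᵥ z) + k ^ 2 * (u ⬝ᵥ u)) := by
    rw [← Nat.cast_smul_eq_nsmul ℝ, mulVec_add, mulVec_smul, hNu, add_dotProduct, dotProduct_add,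
      dotProduct_add, smul_dotProduct, smul_dotProduct, hsymm, dotProduct_smul, dotProduct_smul,
      dotProduct_smul, dotProduct_smul, dotProduct_comm z u]
    simp only [smul_eq_mul]
    ring
  rw [hexp]
  have : 0 ≤ ν * (2 * k * (u ⬝ᵥ z) + k ^ 2 * (u ⬝ᵥ u)) := by positivity
  linarith

/-- The product of one-dimensional Gaussian measures has the product density. -/
theorem pi_gaussianReal_eq_withDensity {ι : Type*} [Fintype ι] (m : ι → ℝ) {v : ι → NNReal}
    (hv : ∀ i, v i ≠ 0) :
    Measure.pi (fun i => gaussianReal (m i) (v i)) =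
      volume.withDensity fun z : ι → ℝ =>
        ENNReal.ofReal (∏ i, gaussianPDFReal (m i) (v i) (z i)) := by
  refine Measure.pi_eq fun s hs => ?_
  have hint : Integrable (fun z : ι → ℝ => ∏ i, gaussianPDFReal (m i) (v i) (z i))
      (Measure.pi fun i => volume.restrict (s i)) :=
    Integrable.fintype_prod fun i => (integrable_gaussianPDFReal (m i) (v i)).integrableOn
  have hnonneg (z : ι → ℝ) : 0 ≤ ∏ i, gaussianPDFReal (m i) (v i) (z i) :=
    Finset.prod_nonneg fun i _ => gaussianPDFReal_nonneg _ _ _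
  rw [withDensity_apply _ (MeasurableSet.univ_pi hs), volume_pi, Measure.restrict_pi_pi,
    ← ofReal_integral_eq_lintegral_ofReal hint (ae_of_all _ hnonneg),
    integral_fintype_prod_eq_prod, ENNReal.ofReal_prod_of_nonneg
      fun i _ => integral_nonneg fun x => gaussianPDFReal_nonneg _ _ _]
  exact Finset.prod_congr rfl fun i _ => (gaussianReal_apply_eq_integral _ (hv i) _).symm

/-- The density of the standard Gaussian measure on `ℝⁿ` is a positive multiple of
`exp (-(z ⬝ᵥ z) / 2)`. -/
theorem prod_gaussianPDFReal_zero_one {ι : Type*} [Fintype ι] (z : ι → ℝ) :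
    ∏ i, gaussianPDFReal 0 1 (z i) =
      (√(2 * Real.pi))⁻¹ ^ Fintype.card ι * Real.exp (-(1 / 2) * (z ⬝ᵥ z)) := by
  simp only [gaussianPDFReal, Finset.prod_mul_distrib, Finset.prod_const, ← Real.exp_sum,
    dotProduct, Finset.mul_sum, Finset.card_univ, NNReal.coe_one, mul_one, sub_zero]
  congr 2
  exact Finset.sum_congr rfl fun i _ => by ring

/-- Every root of the characteristic polynomial of a matrix over a field has an eigenvector. -/
theorem exists_mulVec_eq_smul_of_isRoot_charpoly {ι K : Type*} [Fintype ι] [DecidableEq ι]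
    [Field K] {M : Matrix ι ι K} {a : K} (h : M.charpoly.IsRoot a) :
    ∃ u : ι → K, u ≠ 0 ∧ M *ᵥ u = a • u := by
  rw [Polynomial.IsRoot, eval_charpoly] at h
  obtain ⟨u, hu, h0⟩ := exists_mulVec_eq_zero_iff.mpr h
  refine ⟨u, hu, ?_⟩
  rw [sub_mulVec, sub_eq_zero] at h0
  rw [← h0, scalar_apply, ← smul_one_eq_diagonal, smul_mulVec, one_mulVec]

/-- The moment generating function of a quadratic form in a standard Gaussian vector is infinite
when the form has an eigenvalue at least `1 / 2`. -/
theorem lintegral_exp_quadratic_form_stdGaussian_eq_top {ι : Type*} [Fintype ι]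
    {M : Matrix ι ι ℝ} (hM : M.IsSymm) {u : ι → ℝ} (hu : u ≠ 0) {a : ℝ} (ha : 1 / 2 ≤ a)
    (hMu : M *ᵥ u = a • u) :
    ∫⁻ z, ENNReal.ofReal (Real.exp (z ⬝ᵥ M *ᵥ z)) ∂(Measure.pi fun _ : ι => gaussianReal 0 1)
      = ⊤ := by
  classical
  set c : ℝ := (√(2 * Real.pi))⁻¹ ^ Fintype.card ι with hc
  have hcpos : 0 < c := by positivity
  let N : Matrix ι ι ℝ := M - (1 / 2 : ℝ) • 1
  have hNz (z : ι → ℝ) : N *ᵥ z = M *ᵥ z - (1 / 2 : ℝ) • z := by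
    simp only [N, sub_mulVec, smul_mulVec, one_mulVec]
  have hN : N.IsSymm := hM.sub (isSymm_one.smul _)
  have hNu : N *ᵥ u = (a - 1 / 2) • u := by rw [hNz, hMu, sub_smul]
  have hcont : Continuous fun z : ι → ℝ => z ⬝ᵥ M *ᵥ z := by fun_prop
  have hcont' : Continuous fun z : ι → ℝ => z ⬝ᵥ z := by fun_prop
  rw [pi_gaussianReal_eq_withDensity _ fun _ => one_ne_zero]
  simp only [prod_gaussianPDFReal_zero_one, ← hc]
  rw [lintegral_withDensity_eq_lintegral_mul _ (by fun_prop) (by fun_prop)]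
  have hprod (z : ι → ℝ) : ((fun z : ι → ℝ =>
        ENNReal.ofReal (c * Real.exp (-(1 / 2) * (z ⬝ᵥ z)))) *
        fun z => ENNReal.ofReal (Real.exp (z ⬝ᵥ M *ᵥ z))) z =
      ENNReal.ofReal c * ENNReal.ofReal (Real.exp (z ⬝ᵥ N *ᵥ z)) := by
    rw [Pi.mul_apply, ← ENNReal.ofReal_mul (by positivity), ← ENNReal.ofReal_mul hcpos.le,
      mul_assoc, ← Real.exp_add, hNz, dotProduct_sub, dotProduct_smul, smul_eq_mul]
    congr 3
    ring
  rw [lintegral_congr hprod, lintegral_const_mul' _ _ ENNReal.ofReal_ne_top,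
    lintegral_exp_quadratic_form_eq_top hN hu (sub_nonneg.mpr ha) hNu]
  exact ENNReal.mul_top (ENNReal.ofReal_pos.mpr hcpos).ne'

/-- Bryc–Dembo lemma, infinite part: if `Y ~ N(0, Σ)` with `Σ = A Aᵀ` symmetric
positive semidefinite, `W` is a symmetric real `n × n` matrix, and `λ₁, …, λₙ` are the eigenvalues
of `W Σ` (counted with multiplicity, i.e. the roots of its characteristic polynomial), then for
every real `t` with `max_i t * λᵢ ≥ 1/2`, one has `E[exp (t · Yᵀ W Y)] = +∞`. -/
theorem mgf_gaussian_quadratic_form_eq_top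
    {n : ℕ} (Cov W A : Matrix (Fin n) (Fin n) ℝ)
    (hCov : A * Aᵀ = Cov) (hW : W.IsSymm)
    (lam : Fin n → ℝ)
    (hlam : (W * Cov).charpoly = ∏ i, (Polynomial.X - Polynomial.C (lam i)))
    (t : ℝ) (ht : ∃ i, 1 / 2 ≤ t * lam i) :
    ∫⁻ y, ENNReal.ofReal (Real.exp (t * (y ⬝ᵥ W.mulVec y))) ∂(multivariateGaussianOf A) = ⊤ := by
  subst hCov
  obtain ⟨i, hi⟩ := ht
  have hroot : (Aᵀ * W * A).charpoly.IsRoot (lam i) := by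
    rw [mul_assoc, charpoly_mul_comm, mul_assoc, hlam, Polynomial.IsRoot, Polynomial.eval_prod]
    exact Finset.prod_eq_zero (Finset.mem_univ i) (by simp)
  obtain ⟨u, hu, hMu⟩ := exists_mulVec_eq_smul_of_isRoot_charpoly hroot
  have hsymm : (t • (Aᵀ * W * A)).IsSymm := by
    refine IsSymm.smul ?_ t
    rw [IsSymm, transpose_mul, transpose_mul, transpose_transpose, hW.eq, mul_assoc]
  have hform (z : Fin n → ℝ) :
      t * (A *ᵥ z ⬝ᵥ W *ᵥ (A *ᵥ z)) = z ⬝ᵥ (t • (Aᵀ * W * A)) *ᵥ z := by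
    rw [smul_mulVec, dotProduct_smul, smul_eq_mul, ← mulVec_mulVec, ← mulVec_mulVec,
      dotProduct_mulVec z, vecMul_transpose]
  have hA : Continuous fun z : Fin n → ℝ => A *ᵥ z := by fun_prop
  have hcont : Continuous fun y : Fin n → ℝ => y ⬝ᵥ W *ᵥ y := by fun_prop
  rw [multivariateGaussianOf, lintegral_map (by fun_prop) hA.measurable]
  simp only [hform]
  exact lintegral_exp_quadratic_form_stdGaussian_eq_top hsymm hu hi
    (by rw [smul_mulVec, hMu, smul_smul])
end

section
/- (Grenander–Szegő) Let r : ℤ → ℝ satisfy r(−k) = r(k) and Σ_k |r(k)| < ∞, with spectral density S(ω) = Σ_{k∈ℤ} r(k)e^{−ikω} satisfying m ≤ S(ω) ≤ M for all ω ∈ [0, 2π]. For each n let λ₁⁽ⁿ⁾,…,λₙ⁽ⁿ⁾ be the eigenvalues of the Toeplitz matrix Σ_n = (r(i−j))_{1≤i,j≤n}. Then every eigenvalue λ_i⁽ⁿ⁾ lies in [m, M], and for every continuous function h : [m, M] → ℝ, lim_{n→∞} (1/n) Σ_{i=1}^n h(λ_i⁽ⁿ⁾) = (1/2π) ∫₀^{2π}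 h(S(ω)) dω. -/
open MeasureTheory Matrix Filter Topology

/-- A multiset of eigenvalues of a real symmetric matrix is realised by an orthogonal
diagonalisation; the rows of `Q` are the eigenvectors. -/
theorem Matrix.IsHermitian.exists_orthogonal_diagonalization {n : ℕ}
    {A : Matrix (Fin n) (Fin n) ℝ} (hA : A.IsHermitian) (lam : Fin n → ℝ)
    (hlam : A.charpoly = ∏ i, (Polynomial.X - Polynomial.C (lam i))) :
    ∃ (d : Fin n → ℝ) (Q : Matrix (Fin n) (Fin n) ℝ),
      Finset.univ.val.map lam = Finset.univ.val.map d ∧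
      Q * Qᵀ = 1 ∧ Qᵀ * Q = 1 ∧ Q * A * Qᵀ = diagonal d := by
  refine ⟨hA.eigenvalues, (hA.eigenvectorUnitary : Matrix (Fin n) (Fin n) ℝ)ᵀ, ?_, ?_, ?_, ?_⟩
  · have h1 := hA.roots_charpoly_eq_eigenvalues
    rw [hlam, Polynomial.roots_prod _ _
      (by simp [Finset.prod_ne_zero_iff, Polynomial.X_sub_C_ne_zero])] at h1
    simpa [Multiset.bind_singleton, Function.comp_def] using h1
  · simpa [star_eq_conjTranspose] using Unitary.coe_star_mul_self hA.eigenvectorUnitary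
  · simpa [star_eq_conjTranspose] using Unitary.coe_mul_star_self hA.eigenvectorUnitary
  · have h1 := hA.conjStarAlgAut_star_eigenvectorUnitary
    rw [Unitary.conjStarAlgAut_star_apply] at h1
    simpa [star_eq_conjTranspose, Function.comp_def] using h1

theorem integral_cos_int_mul (k : ℤ) :
    ∫ ω in (0 : ℝ)..(2 * Real.pi), Real.cos (k * ω) = if k = 0 then 2 * Real.pi else 0 := by
  split_ifs with hk
  · simp [hk]
  · have hk' : (k : ℝ) ≠ 0 := by exact_mod_cast hk
    rw [intervalIntegral.integral_comp_mul_left (fun x => Real.cos x) hk', integral_cos]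
    have h1 : Real.sin (k * (2 * Real.pi)) = 0 := by
      have := Real.sin_int_mul_pi (2 * k)
      push_cast at this
      rw [← this]; congr 1; ring
    simp [h1]

theorem integral_cos_int_mul_mul_cos (k l : ℤ) :
    ∫ ω in (0 : ℝ)..(2 * Real.pi), Real.cos (k * ω) * Real.cos (l * ω)
      = (if k = l then Real.pi else 0) + if k = -l then Real.pi else 0 := by
  have h1 : ∀ ω : ℝ, Real.cos (k * ω) * Real.cos (l * ω)
      = 2⁻¹ * (Real.cos ((k - l : ℤ) * ω) + Real.cos ((k + l : ℤ) * ω)) := by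
    intro ω
    have := Real.two_mul_cos_mul_cos (k * ω) (l * ω)
    push_cast
    rw [sub_mul, add_mul, ← this]; ring
  simp_rw [h1]
  rw [intervalIntegral.integral_const_mul, intervalIntegral.integral_add
    (by apply Continuous.intervalIntegrable; fun_prop)
    (by apply Continuous.intervalIntegrable; fun_prop), integral_cos_int_mul, integral_cos_int_mul]
  simp only [sub_eq_zero, add_eq_zero_iff_eq_neg]
  split_ifs <;> ring

/-- Integration of an absolutely convergent cosine series against a continuous function. -/
theorem hasSum_integral_cos_series {r : ℤ → ℝ} (hsum : Summable fun k => |r k|) {S : ℝ → ℝ}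
    (hS : ∀ ω : ℝ, HasSum (fun k : ℤ => r k * Real.cos (k * ω)) (S ω))
    {g : ℝ → ℝ} (hg : Continuous g) :
    HasSum (fun k : ℤ => r k * ∫ ω in (0 : ℝ)..(2 * Real.pi), Real.cos (k * ω) * g ω)
      (∫ ω in (0 : ℝ)..(2 * Real.pi), S ω * g ω) := by
  simp_rw [← intervalIntegral.integral_const_mul]
  refine intervalIntegral.hasSum_integral_of_dominated_convergence
    (fun k ω => |r k| * |g ω|) (fun k => ?_) (fun k => ?_) ?_ ?_ ?_
  · exact Continuous.aestronglyMeasurable (by fun_prop)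
  · refine Eventually.of_forall fun ω _ => ?_
    rw [norm_mul, norm_mul, Real.norm_eq_abs, Real.norm_eq_abs, Real.norm_eq_abs]
    have := mul_le_mul_of_nonneg_right (Real.abs_cos_le_one (k * ω)) (abs_nonneg (g ω))
    rw [one_mul] at this
    gcongr
  · exact Eventually.of_forall fun ω _ => hsum.mul_right _
  · simp_rw [tsum_mul_right]
    exact Continuous.intervalIntegrable (by fun_prop) _ _
  · refine Eventually.of_forall fun ω _ => ?_
    simpa only [mul_assoc] using (hS ω).mul_right (g ω)

theorem integral_cos_series_mul_cos {r : ℤ → ℝ} (hsymm : ∀ k, r (-k) = r k)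
    (hsum : Summable fun k => |r k|) {S : ℝ → ℝ}
    (hS : ∀ ω : ℝ, HasSum (fun k : ℤ => r k * Real.cos (k * ω)) (S ω)) (l : ℤ) :
    ∫ ω in (0 : ℝ)..(2 * Real.pi), S ω * Real.cos (l * ω) = 2 * Real.pi * r l := by
  have h1 := hasSum_integral_cos_series hsum hS (g := fun ω => Real.cos (l * ω)) (by fun_prop)
  simp_rw [integral_cos_int_mul_mul_cos, mul_add, mul_ite, mul_zero] at h1
  have h2 := (hasSum_ite_eq l (r l * Real.pi)).add (hasSum_ite_eq (-l) (r (-l) * Real.pi))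
  have h3 : (fun k : ℤ => (if k = l then r k * Real.pi else 0)
      + if k = -l then r k * Real.pi else 0)
      = fun k : ℤ => (if k = l then r l * Real.pi else 0)
      + if k = -l then r (-l) * Real.pi else 0 := by
    funext k
    congr 1
    · split_ifs with h <;> simp [h]
    · split_ifs with h <;> simp [h]
  rw [h3] at h1
  rw [h1.unique h2, hsymm]
  ring

/-- Parseval's identity for a cosine series. -/
theorem hasSum_sq_of_cos_series {r : ℤ → ℝ} (hsymm : ∀ k, r (-k) = r k)
    (hsum : Summable fun k => |r k|) {S : ℝ → ℝ} (hcont : Continuous S)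
    (hS : ∀ ω : ℝ, HasSum (fun k : ℤ => r k * Real.cos (k * ω)) (S ω)) :
    HasSum (fun k => r k ^ 2) ((2 * Real.pi)⁻¹ * ∫ ω in (0 : ℝ)..(2 * Real.pi), S ω ^ 2) := by
  have h1 := hasSum_integral_cos_series hsum hS hcont
  simp_rw [mul_comm (Real.cos _), integral_cos_series_mul_cos hsymm hsum hS, ← pow_two] at h1
  refine (h1.mul_left (2 * Real.pi)⁻¹).congr_fun fun k => ?_
  field_simp

theorem sum_fin_sum_fin_succ_sub (f : ℤ → ℝ) (n : ℕ) :
    ∑ i : Fin (n + 1), ∑ j : Fin (n + 1), f ((i.val : ℤ) - (j.val : ℤ))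
      = (∑ i : Fin n, ∑ j : Fin n, f ((i.val : ℤ) - (j.val : ℤ)))
        + ∑ k ∈ Finset.Icc (-n : ℤ) n, f k := by
  have h1 : ∀ n : ℕ, ∑ k ∈ Finset.Icc (-n : ℤ) n, f k
      = ∑ j ∈ Finset.range n, f ((j : ℤ) - n) + (∑ j ∈ Finset.range n, f ((n : ℤ) - j)) + f 0 := by
    intro n
    induction n with
    | zero => simp
    | succ n ih =>
      have h2 : Finset.Icc (-(n + 1 : ℕ) : ℤ) (n + 1 : ℕ)
          = insert (-(n + 1 : ℤ)) (insert (n + 1 : ℤ) (Finset.Icc (-n : ℤ) n)) := by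
        ext x; simp; omega
      rw [h2, Finset.sum_insert (by simp; omega), Finset.sum_insert (by simp), ih,
        Finset.sum_range_succ', Finset.sum_range_succ']
      push_cast
      simp only [add_sub_add_right_eq_sub, sub_zero, zero_sub]
      ring
  rw [h1, Fin.sum_univ_castSucc]
  simp_rw [Fin.sum_univ_castSucc, Fin.val_castSucc, Fin.val_last, Finset.sum_add_distrib,
    sub_self]
  rw [Fin.sum_univ_eq_sum_range (fun j => f ((j : ℤ) - n)),
    Fin.sum_univ_eq_sum_range (fun j => f ((n : ℤ) - j))]
  ring

theorem tendsto_average_toeplitz {f : ℤ → ℝ} {a : ℝ} (hf : HasSum f a) :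
    Tendsto (fun n : ℕ => (n : ℝ)⁻¹ *
      ∑ i : Fin n, ∑ j : Fin n, f ((i.val : ℤ) - (j.val : ℤ))) atTop (𝓝 a) := by
  have h1 : Tendsto (fun n : ℕ => ∑ k ∈ Finset.Icc (-n : ℤ) n, f k) atTop (𝓝 a) :=
    (show Tendsto (fun s : Finset ℤ => ∑ k ∈ s, f k) atTop (𝓝 a) by
      simpa [HasSum] using hf).comp Finset.tendsto_Icc_neg
  convert h1.cesaro using 3 with n
  induction n with
  | zero => simp
  | succ n ih => rw [sum_fin_sum_fin_succ_sub, ih, Finset.sum_range_succ]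

theorem ContinuousOn.exists_abs_sub_le_add_mul_sq {h : ℝ → ℝ} {m M : ℝ}
    (hh : ContinuousOn h (Set.Icc m M)) {ε : ℝ} (hε : 0 < ε) :
    ∃ C : ℝ, 0 ≤ C ∧ ∀ x ∈ Set.Icc m M, ∀ y ∈ Set.Icc m M,
      |h x - h y| ≤ ε + C * (x - y) ^ 2 := by
  obtain ⟨B, hB⟩ := isCompact_Icc.exists_bound_of_continuousOn hh
  obtain ⟨δ, hδ, hu⟩ := Metric.uniformContinuousOn_iff.1
    (isCompact_Icc.uniformContinuousOn_of_continuous hh) ε hε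
  refine ⟨2 * |B| / δ ^ 2, by positivity, fun x hx y hy => ?_⟩
  by_cases hxy : dist x y < δ
  · have h1 := hu x hx y hy hxy
    rw [Real.dist_eq] at h1
    have : 0 ≤ 2 * |B| / δ ^ 2 * (x - y) ^ 2 := by positivity
    linarith
  · rw [Real.dist_eq, not_lt] at hxy
    have h1 : δ ^ 2 ≤ (x - y) ^ 2 := by rw [← sq_abs (x - y)]; gcongr
    have h2 : 2 * |B| ≤ 2 * |B| / δ ^ 2 * (x - y) ^ 2 := by
      rw [div_mul_eq_mul_div, le_div_iff₀ (by positivity)]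
      gcongr
    have h3 := abs_sub (h x) (h y)
    have h4 := (hB x hx).trans (le_abs_self B)
    have h5 := (hB y hy).trans (le_abs_self B)
    rw [Real.norm_eq_abs] at h4 h5
    linarith

/-- The squared modulus of the trigonometric polynomial with coefficients `u`. -/
noncomputable def trigWeight {n : ℕ} (u : Fin n → ℝ) (ω : ℝ) : ℝ :=
  ∑ j : Fin n, ∑ l : Fin n, u j * u l * Real.cos (((j.val : ℤ) - (l.val : ℤ) : ℤ) * ω)

theorem continuous_trigWeight {n : ℕ} (u : Fin n → ℝ) : Continuous (trigWeight u) := by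
  unfold trigWeight
  fun_prop

theorem trigWeight_nonneg {n : ℕ} (u : Fin n → ℝ) (ω : ℝ) : 0 ≤ trigWeight u ω := by
  have h1 : trigWeight u ω = (∑ j : Fin n, u j * Real.cos (j.val * ω)) ^ 2
      + (∑ j : Fin n, u j * Real.sin (j.val * ω)) ^ 2 := by
    rw [pow_two, pow_two, Finset.sum_mul_sum, Finset.sum_mul_sum, ← Finset.sum_add_distrib]
    refine Finset.sum_congr rfl fun j _ => ?_
    rw [← Finset.sum_add_distrib]
    refine Finset.sum_congr rfl fun l _ => ?_
    push_cast
    rw [sub_mul, Real.cos_sub]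
    ring
  rw [h1]
  positivity

theorem integral_mul_trigWeight {n : ℕ} (u : Fin n → ℝ) {g : ℝ → ℝ} (hg : Continuous g) :
    ∫ ω in (0 : ℝ)..(2 * Real.pi), g ω * trigWeight u ω
      = ∑ j : Fin n, ∑ l : Fin n, u j * u l *
        ∫ ω in (0 : ℝ)..(2 * Real.pi), g ω * Real.cos (((j.val : ℤ) - (l.val : ℤ) : ℤ) * ω) := by
  simp_rw [trigWeight, Finset.mul_sum]
  rw [intervalIntegral.integral_finsetSum
    fun j _ => Continuous.intervalIntegrable (by fun_prop) _ _]
  refine Finset.sum_congr rfl fun j _ => ?_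
  rw [intervalIntegral.integral_finsetSum
    fun l _ => Continuous.intervalIntegrable (by fun_prop) _ _]
  refine Finset.sum_congr rfl fun l _ => ?_
  rw [← intervalIntegral.integral_const_mul]
  congr 1
  funext ω
  ring

theorem integral_trigWeight {n : ℕ} (u : Fin n → ℝ) (hu : ∑ j, u j * u j = 1) :
    ∫ ω in (0 : ℝ)..(2 * Real.pi), trigWeight u ω = 2 * Real.pi := by
  have h1 := integral_mul_trigWeight u (g := fun _ => 1) continuous_const
  simp only [one_mul, integral_cos_int_mul, sub_eq_zero, Nat.cast_inj, Fin.val_inj, mul_ite,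
    mul_zero, Finset.sum_ite_eq, Finset.mem_univ, if_true] at h1
  rw [h1, ← Finset.sum_mul, hu, one_mul]

theorem sum_trigWeight {n : ℕ} {Q : Matrix (Fin n) (Fin n) ℝ} (hQ : Qᵀ * Q = 1) (ω : ℝ) :
    ∑ i, trigWeight (Q i) ω = n := by
  unfold trigWeight
  have h1 : ∀ j l, ∑ i, Q i j * Q i l = if j = l then 1 else 0 := fun j l => by
    rw [← Matrix.one_apply, ← hQ, Matrix.mul_apply]
    rfl
  have h2 : ∀ j : Fin n, ∑ i, ∑ l : Fin n,
      Q i j * Q i l * Real.cos (((j.val : ℤ) - (l.val : ℤ) : ℤ) * ω) = 1 := by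
    intro j
    rw [Finset.sum_comm]
    simp_rw [← Finset.sum_mul, h1]
    simp
  rw [Finset.sum_comm, Finset.sum_congr rfl fun j _ => h2 j]
  simp

/-- The quadratic form of the Toeplitz matrix, as an integral against its symbol. -/
theorem integral_symbol_mul_trigWeight {r : ℤ → ℝ} (hsymm : ∀ k, r (-k) = r k)
    (hsum : Summable fun k => |r k|) {S : ℝ → ℝ} (hcont : Continuous S)
    (hS : ∀ ω : ℝ, HasSum (fun k : ℤ => r k * Real.cos (k * ω)) (S ω))
    {n : ℕ} {d : Fin n → ℝ} {Q : Matrix (Fin n) (Fin n) ℝ}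
    (hQ : Q * (Matrix.of fun i j : Fin n => r ((i.val : ℤ) - (j.val : ℤ))) * Qᵀ = diagonal d)
    (i : Fin n) :
    ∫ ω in (0 : ℝ)..(2 * Real.pi), S ω * trigWeight (Q i) ω = 2 * Real.pi * d i := by
  rw [integral_mul_trigWeight _ hcont]
  simp_rw [integral_cos_series_mul_cos hsymm hsum hS]
  have h1 := congrFun (congrFun hQ i) i
  rw [diagonal_apply_eq] at h1
  rw [← h1, Matrix.mul_apply, Finset.sum_comm, Finset.mul_sum]
  refine Finset.sum_congr rfl fun l _ => ?_
  rw [Matrix.mul_apply, Finset.sum_mul, Finset.mul_sum]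
  refine Finset.sum_congr rfl fun j _ => ?_
  simp only [of_apply, transpose_apply]
  ring

theorem sum_sq_eq_of_orthogonal_diagonalization {n : ℕ} {A Q : Matrix (Fin n) (Fin n) ℝ}
    {d : Fin n → ℝ} (hA : Aᵀ = A) (hQ : Qᵀ * Q = 1) (hd : Q * A * Qᵀ = diagonal d) :
    ∑ i, d i ^ 2 = ∑ i, ∑ j, A i j ^ 2 := by
  have h1 : (diagonal d * diagonal d).trace = (A * Aᵀ).trace := by
    rw [← hd, hA]
    calc (Q * A * Qᵀ * (Q * A * Qᵀ)).trace = (Q * A * (Qᵀ * Q) * A * Qᵀ).trace := by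
          simp only [Matrix.mul_assoc]
      _ = (Qᵀ * (Q * A * (Qᵀ * Q) * A)).trace := Matrix.trace_mul_comm _ _
      _ = ((Qᵀ * Q) * A * (Qᵀ * Q) * A).trace := by simp only [Matrix.mul_assoc]
      _ = (A * A).trace := by rw [hQ, Matrix.one_mul, Matrix.mul_one]
  rw [diagonal_mul_diagonal] at h1
  simpa only [Matrix.trace, Matrix.mul_apply, diag_apply,
    diagonal_apply_eq, transpose_apply, ← pow_two] using h1

/-- If the symbol takes values in `[m, M]`, so do the eigenvalues. -/
theorem toeplitz_eigenvalue_mem_Icc {S : ℝ → ℝ} (hcont : Continuous S) {m M : ℝ}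
    (hbound : ∀ ω ∈ Set.Icc (0 : ℝ) (2 * Real.pi), S ω ∈ Set.Icc m M)
    {n : ℕ} {u : Fin n → ℝ} (hu : ∑ j, u j * u j = 1) {x : ℝ}
    (hx : ∫ ω in (0 : ℝ)..(2 * Real.pi), S ω * trigWeight u ω = 2 * Real.pi * x) :
    x ∈ Set.Icc m M := by
  have hw := continuous_trigWeight u
  have hc : ∀ c : ℝ, ∫ ω in (0 : ℝ)..(2 * Real.pi), c * trigWeight u ω = 2 * Real.pi * c := by
    intro c
    rw [intervalIntegral.integral_const_mul, integral_trigWeight u hu, mul_comm]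
  constructor
  · refine le_of_mul_le_mul_left ?_ Real.two_pi_pos
    rw [← hx, ← hc]
    refine intervalIntegral.integral_mono_on Real.two_pi_pos.le
      (Continuous.intervalIntegrable (by fun_prop) _ _)
      (Continuous.intervalIntegrable (by fun_prop) _ _) fun ω hω => ?_
    exact mul_le_mul_of_nonneg_right (hbound ω hω).1 (trigWeight_nonneg u ω)
  · refine le_of_mul_le_mul_left ?_ Real.two_pi_pos
    rw [← hx, ← hc]
    refine intervalIntegral.integral_mono_on Real.two_pi_pos.le
      (Continuous.intervalIntegrable (by fun_prop) _ _)
      (Continuous.intervalIntegrable (by fun_prop) _ _) fun ω hω => ?_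
    exact mul_le_mul_of_nonneg_right (hbound ω hω).2 (trigWeight_nonneg u ω)

/-- The eigenvalues and the symbol are coupled by the weights `trigWeight (Q i)`, so the distance
between their distributions is controlled by the defect in second moments. -/
theorem abs_sum_sub_integral_le {S : ℝ → ℝ} (hcont : Continuous S) {m M : ℝ}
    (hbound : ∀ ω ∈ Set.Icc (0 : ℝ) (2 * Real.pi), S ω ∈ Set.Icc m M)
    {h : ℝ → ℝ} (hh : ContinuousOn h (Set.Icc m M)) {ε C : ℝ}
    (hC : ∀ x ∈ Set.Icc m M, ∀ y ∈ Set.Icc m M, |h x - h y| ≤ ε + C * (x - y) ^ 2)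
    {n : ℕ} {d : Fin n → ℝ} {Q : Matrix (Fin n) (Fin n) ℝ}
    (hQ : Q * Qᵀ = 1) (hQ' : Qᵀ * Q = 1) (hd : ∀ i, d i ∈ Set.Icc m M)
    (hSd : ∀ i, ∫ ω in (0 : ℝ)..(2 * Real.pi), S ω * trigWeight (Q i) ω = 2 * Real.pi * d i) :
    |2 * Real.pi * ∑ i, h (d i) - n * ∫ ω in (0 : ℝ)..(2 * Real.pi), h (S ω)|
      ≤ 2 * Real.pi * (n * ε) + C * (n * (∫ ω in (0 : ℝ)..(2 * Real.pi), S ω ^ 2)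
        - 2 * Real.pi * ∑ i, d i ^ 2) := by
  have hu : ∀ i, ∑ j, Q i j * Q i j = 1 := fun i => by
    have := congrFun (congrFun hQ i) i
    simpa [Matrix.mul_apply] using this
  have hw : ∀ i, Continuous (trigWeight (Q i)) := fun i => continuous_trigWeight _
  have hhS : ContinuousOn (fun ω => h (S ω)) (Set.uIcc 0 (2 * Real.pi)) := by
    rw [Set.uIcc_of_le Real.two_pi_pos.le]
    exact hh.comp hcont.continuousOn hbound
  have hsplit : ∀ g : ℝ → ℝ, ContinuousOn g (Set.uIcc 0 (2 * Real.pi)) →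
      n * ∫ ω in (0 : ℝ)..(2 * Real.pi), g ω
        = ∑ i, ∫ ω in (0 : ℝ)..(2 * Real.pi), g ω * trigWeight (Q i) ω := by
    intro g hg
    have hint : ∀ i ∈ Finset.univ, IntervalIntegrable (fun ω => g ω * trigWeight (Q i) ω) volume
        0 (2 * Real.pi) := fun i _ => (hg.mul (hw i).continuousOn).intervalIntegrable
    rw [← intervalIntegral.integral_finsetSum hint]
    simp_rw [← Finset.mul_sum, sum_trigWeight hQ']
    rw [intervalIntegral.integral_mul_const, mul_comm]
  have hconst : ∀ i (c : ℝ), ∫ ω in (0 : ℝ)..(2 * Real.pi), c * trigWeight (Q i) ω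
      = 2 * Real.pi * c := by
    intro i c
    rw [intervalIntegral.integral_const_mul, integral_trigWeight _ (hu i), mul_comm]
  have hterm : ∀ i, |2 * Real.pi * h (d i)
        - ∫ ω in (0 : ℝ)..(2 * Real.pi), h (S ω) * trigWeight (Q i) ω|
      ≤ 2 * Real.pi * ε + C * ((∫ ω in (0 : ℝ)..(2 * Real.pi), S ω ^ 2 * trigWeight (Q i) ω)
        - 2 * Real.pi * d i ^ 2) := by
    intro i
    have hwi := hw i
    have e1 : ∫ ω in (0 : ℝ)..(2 * Real.pi), (ε + C * (d i - S ω) ^ 2) * trigWeight (Q i) ω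
        = 2 * Real.pi * ε + C * ((∫ ω in (0 : ℝ)..(2 * Real.pi), S ω ^ 2 * trigWeight (Q i) ω)
        - 2 * Real.pi * d i ^ 2) := by
      have e2 : ∀ ω, (ε + C * (d i - S ω) ^ 2) * trigWeight (Q i) ω
          = (ε + C * d i ^ 2) * trigWeight (Q i) ω
            + (C * (S ω ^ 2 * trigWeight (Q i) ω)
              - (2 * C * d i) * (S ω * trigWeight (Q i) ω)) := fun ω => by ring
      simp_rw [e2]
      rw [intervalIntegral.integral_add (Continuous.intervalIntegrable (by fun_prop) _ _)
        (Continuous.intervalIntegrable (by fun_prop) _ _),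
        intervalIntegral.integral_sub (Continuous.intervalIntegrable (by fun_prop) _ _)
        (Continuous.intervalIntegrable (by fun_prop) _ _), hconst,
        intervalIntegral.integral_const_mul, intervalIntegral.integral_const_mul, hSd]
      ring
    have hint : IntervalIntegrable (fun ω => h (S ω) * trigWeight (Q i) ω) volume
        0 (2 * Real.pi) := (hhS.mul hwi.continuousOn).intervalIntegrable
    have hint' : IntervalIntegrable (fun ω => h (d i) * trigWeight (Q i) ω) volume
        0 (2 * Real.pi) := (continuous_const.mul hwi).intervalIntegrable _ _
    rw [← e1, ← hconst i (h (d i)), ← intervalIntegral.integral_sub hint' hint]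
    refine (intervalIntegral.abs_integral_le_integral_abs Real.two_pi_pos.le).trans ?_
    refine intervalIntegral.integral_mono_on Real.two_pi_pos.le ?_
      (Continuous.intervalIntegrable (by fun_prop) _ _) fun ω hω => ?_
    · exact (hint'.sub hint).abs
    · rw [← sub_mul, abs_mul, abs_of_nonneg (trigWeight_nonneg (Q i) ω)]
      exact mul_le_mul_of_nonneg_right (hC _ (hd i) _ (hbound ω hω)) (trigWeight_nonneg _ _)
  rw [hsplit _ hhS, hsplit _ (by fun_prop), Finset.mul_sum, ← Finset.sum_sub_distrib]
  refine (Finset.abs_sum_le_sum_abs _ _).trans ((Finset.sum_le_sum fun i _ => hterm i).trans ?_)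
  rw [Finset.sum_add_distrib, ← Finset.mul_sum, ← Finset.mul_sum, Finset.sum_sub_distrib,
    ← Finset.mul_sum]
  simp only [Finset.sum_const, Finset.card_univ, Fintype.card_fin, nsmul_eq_mul]
  apply le_of_eq
  ring

/-- Grenander–Szegő: let `r : ℤ → ℝ` be a symmetric absolutely summable
autocovariance sequence with spectral density `S(ω) = ∑_{k ∈ ℤ} r(k) e^{-ikω}` satisfying
`m ≤ S(ω) ≤ M` on `[0, 2π]`, and for each `n` let `λ₁⁽ⁿ⁾, …, λₙ⁽ⁿ⁾` be the eigenvalues of the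
Toeplitz matrix `Σₙ = (r(i-j))`.  Then every eigenvalue lies in `[m, M]`, and for every continuous
`h : [m, M] → ℝ`, `(1/n) ∑ᵢ h(λᵢ⁽ⁿ⁾) → (1/2π) ∫₀^{2π} h(S(ω)) dω`. -/
theorem toeplitz_eigenvalue_distribution
    (r : ℤ → ℝ) (hsymm : ∀ k, r (-k) = r k) (hsum : Summable fun k => |r k|)
    (S : ℝ → ℝ)
    (hS : ∀ ω : ℝ, (S ω : ℂ) = ∑' k : ℤ, (r k : ℂ) * Complex.exp (-Complex.I * k * ω))
    (m M : ℝ) (hbound : ∀ ω ∈ Set.Icc (0 : ℝ) (2 * Real.pi), S ω ∈ Set.Icc m M)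
    (lam : (n : ℕ) → Fin n → ℝ)
    (hlam : ∀ n : ℕ, (Matrix.of fun i j : Fin n => r ((i.val : ℤ) - (j.val : ℤ))).charpoly
        = ∏ i, (Polynomial.X - Polynomial.C (lam n i))) :
    (∀ n : ℕ, ∀ i : Fin n, lam n i ∈ Set.Icc m M) ∧
    ∀ h : ℝ → ℝ, ContinuousOn h (Set.Icc m M) →
      Tendsto (fun n : ℕ => (1 / (n : ℝ)) * ∑ i, h (lam n i)) atTop
        (𝓝 ((1 / (2 * Real.pi)) * ∫ ω in (0 : ℝ)..(2 * Real.pi), h (S ω))) := by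
  have hcosS : ∀ ω : ℝ, HasSum (fun k : ℤ => r k * Real.cos (k * ω)) (S ω) := by
    intro ω
    have hsC : Summable fun k : ℤ => (r k : ℂ) * Complex.exp (-Complex.I * k * ω) := by
      refine Summable.of_norm (hsum.congr fun k => ?_)
      have : -Complex.I * k * ω = ((-(k * ω) : ℝ) : ℂ) * Complex.I := by push_cast; ring
      rw [norm_mul, this, Complex.norm_exp_ofReal_mul_I, Complex.norm_real, Real.norm_eq_abs,
        mul_one]
    have h1 := Complex.hasSum_re (hS ω ▸ hsC.hasSum)
    rw [Complex.ofReal_re] at h1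
    refine h1.congr_fun ?_
    intro k
    have : -Complex.I * k * ω = ((-(k * ω) : ℝ) : ℂ) * Complex.I := by push_cast; ring
    rw [this, Complex.re_ofReal_mul, Complex.exp_ofReal_mul_I_re, Real.cos_neg]
  have hcont : Continuous S := by
    have h1 : S = fun ω => ∑' k : ℤ, r k * Real.cos (k * ω) :=
      funext fun ω => (hcosS ω).tsum_eq.symm
    rw [h1]
    refine continuous_tsum (fun k => by fun_prop) hsum fun k ω => ?_
    rw [norm_mul, Real.norm_eq_abs, Real.norm_eq_abs]
    exact mul_le_of_le_one_right (abs_nonneg _) (Real.abs_cos_le_one _)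
  have hT : ∀ n : ℕ, (Matrix.of fun i j : Fin n => r ((i.val : ℤ) - (j.val : ℤ)))ᵀ
      = Matrix.of fun i j : Fin n => r ((i.val : ℤ) - (j.val : ℤ)) := by
    intro n
    ext i j
    simp only [transpose_apply, of_apply]
    rw [← hsymm, neg_sub]
  have hdiag := fun n => Matrix.IsHermitian.exists_orthogonal_diagonalization
    (A := Matrix.of fun i j : Fin n => r ((i.val : ℤ) - (j.val : ℤ)))
    (by rw [Matrix.IsHermitian, conjTranspose_eq_transpose_of_trivial, hT]) (lam n) (hlam n)
  choose d Q hperm hQ hQ' hd using hdiag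
  have hSd := fun n => integral_symbol_mul_trigWeight hsymm hsum hcont hcosS (hd n)
  have hmem : ∀ n i, d n i ∈ Set.Icc m M := fun n i =>
    toeplitz_eigenvalue_mem_Icc hcont hbound
      (by simpa [Matrix.mul_apply] using congrFun (congrFun (hQ n) i) i) (hSd n i)
  refine ⟨fun n i => ?_, fun h hh => ?_⟩
  · have h1 : lam n i ∈ Finset.univ.val.map (d n) := by
      rw [← hperm]
      exact Multiset.mem_map_of_mem _ (Finset.mem_univ i)
    obtain ⟨j, -, hj⟩ := Multiset.mem_map.1 h1
    exact hj ▸ hmem n j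
  · have hsumh : ∀ n, ∑ i, h (lam n i) = ∑ i, h (d n i) := by
      intro n
      have h1 := congrArg (fun s => (s.map h).sum) (hperm n)
      rw [Multiset.map_map, Multiset.map_map] at h1
      exact h1
    have hmoment := (tendsto_average_toeplitz
      (hasSum_sq_of_cos_series hsymm hsum hcont hcosS)).const_sub
      ((2 * Real.pi)⁻¹ * ∫ ω in (0 : ℝ)..(2 * Real.pi), S ω ^ 2)
    rw [sub_self] at hmoment
    rw [Metric.tendsto_atTop]
    intro ε hε
    obtain ⟨C, -, hC⟩ := hh.exists_abs_sub_le_add_mul_sq (half_pos hε)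
    have hsmall := (hmoment.const_mul C).eventually_lt_const
      (show C * 0 < ε / 2 by simpa using half_pos hε)
    obtain ⟨N, hN⟩ := eventually_atTop.1 (hsmall.and (eventually_gt_atTop 0))
    refine ⟨N, fun n hn => ?_⟩
    obtain ⟨hlt, hpos⟩ := hN n hn
    have hpos' : (0 : ℝ) < n := Nat.cast_pos.2 hpos
    have hpi := Real.two_pi_pos
    have hmain := abs_sum_sub_integral_le hcont hbound hh hC (hQ n) (hQ' n) (hmem n) (hSd n)
    rw [sum_sq_eq_of_orthogonal_diagonalization (hT n) (hQ' n) (hd n)] at hmain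
    simp only [of_apply] at hmain
    set J := ∫ ω in (0 : ℝ)..(2 * Real.pi), h (S ω)
    set K := ∫ ω in (0 : ℝ)..(2 * Real.pi), S ω ^ 2
    set D := ∑ i : Fin n, ∑ j : Fin n, r ((i.val : ℤ) - (j.val : ℤ)) ^ 2
    set p := 2 * Real.pi
    rw [Real.dist_eq, hsumh]
    have e1 : 1 / (n : ℝ) * ∑ i, h (d n i) - 1 / p * J
        = (p * n)⁻¹ * (p * ∑ i, h (d n i) - n * J) := by
      field_simp
    have e2 : (p * n)⁻¹ * (p * (n * (ε / 2)) + C * (n * K - p * D))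
        = ε / 2 + C * (p⁻¹ * K - (n : ℝ)⁻¹ * D) := by
      field_simp
    rw [e1, abs_mul, abs_of_pos (by positivity : 0 < (p * n)⁻¹)]
    calc _ ≤ (p * n)⁻¹ * (p * (n * (ε / 2)) + C * (n * K - p * D)) := by gcongr
      _ < ε := by rw [e2]; linarith
end

section
/- (Large deviations upper bound for Gaussian quadratic averages) Let r : ℤ → ℝ satisfy r(−k) = r(k) and Σ_k |r(k)| < ∞, with spectral density S(ω) = Σ_{k∈ℤ} r(k)e^{−ikω} satisfying 0 ≤ S(ω) ≤ M for all ω, and suppose each Toeplitz matrix Σ_n = (r(i−j))_{1≤i,j≤n} is positive semidefinite. For each n let X_n ~ N(0, Σ_n) and let P_n be the law of Z_n = (1/n)Σ_{i=1}^n (X_n)_i². Define Λ(t) = −(1/4π)∫₀^{2π} log(1 − 2 t S(ω)) dω for t < 1/(2M), and I(z) = sup_{t < 1/(2M)} [z·t − Λ(t)]. Then for every closed set C ⊆ ℝ, limsup_{n→∞} (1/n) log P_n(C) ≤ − inf_{z ∈ C} I(z). -/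
open MeasureTheory Matrix ProbabilityTheory Filter Topology

section SpectralDensity

variable {r : ℤ → ℝ} {S : ℝ → ℝ}

lemma norm_exp_neg_I_mul_int_mul (k : ℤ) (ω : ℝ) :
    ‖Complex.exp (-Complex.I * k * ω)‖ = 1 := by
  have : -Complex.I * k * ω = ((-(k * ω) : ℝ) : ℂ) * Complex.I := by push_cast; ring
  rw [this, Complex.norm_exp_ofReal_mul_I]

lemma continuous_of_fourier_series (hsum : Summable fun k => |r k|)
    (hS : ∀ ω : ℝ, (S ω : ℂ) = ∑' k : ℤ, (r k : ℂ) * Complex.exp (-Complex.I * k * ω)) :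
    Continuous S := by
  have h : Continuous fun ω : ℝ => ∑' k : ℤ, (r k : ℂ) * Complex.exp (-Complex.I * k * ω) := by
    refine continuous_tsum (fun k => by fun_prop) hsum fun k ω => ?_
    rw [norm_mul, norm_exp_neg_I_mul_int_mul, mul_one, Complex.norm_real, Real.norm_eq_abs]
  have : S = fun ω : ℝ => (∑' k : ℤ, (r k : ℂ) * Complex.exp (-Complex.I * k * ω)).re := by
    ext ω; rw [← hS, Complex.ofReal_re]
  rw [this]
  exact Complex.continuous_re.comp h

lemma integral_exp_I_mul_int (m : ℤ) :
    ∫ ω in (0 : ℝ)..(2 * Real.pi), Complex.exp (Complex.I * m * ω) =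
      if m = 0 then ((2 * Real.pi : ℝ) : ℂ) else 0 := by
  split_ifs with h
  · simp [h]
  · rw [integral_exp_mul_complex (by simp [h])]
    have : Complex.I * m * ((2 * Real.pi : ℝ) : ℂ) = m * (2 * Real.pi * Complex.I) := by
      push_cast; ring
    rw [this, Complex.exp_int_mul_two_pi_mul_I]
    simp

lemma integral_mul_exp_of_fourier_series (hsum : Summable fun k => |r k|)
    (hS : ∀ ω : ℝ, (S ω : ℂ) = ∑' k : ℤ, (r k : ℂ) * Complex.exp (-Complex.I * k * ω)) (m : ℤ) :
    ∫ ω in (0 : ℝ)..(2 * Real.pi), (S ω : ℂ) * Complex.exp (Complex.I * m * ω) =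
      ((2 * Real.pi : ℝ) : ℂ) * r m := by
  let f : ℤ → C(ℝ, ℂ) := fun k =>
    ⟨fun ω => (r k : ℂ) * Complex.exp (Complex.I * (m - k : ℤ) * ω), by fun_prop⟩
  have hnorm : ∀ (k : ℤ) (ω : ℝ), ‖f k ω‖ = |r k| := fun k ω => by
    have : Complex.I * (m - k : ℤ) * ω = -Complex.I * (k - m : ℤ) * ω := by push_cast; ring
    simp only [f, ContinuousMap.coe_mk]
    rw [this, norm_mul, norm_exp_neg_I_mul_int_mul, mul_one, Complex.norm_real, Real.norm_eq_abs]
  have key := intervalIntegral.hasSum_intervalIntegral_of_summable_norm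
    (a := (0 : ℝ)) (b := 2 * Real.pi) (f := f) <| by
      refine Summable.of_nonneg_of_le (fun _ => norm_nonneg _) (fun k => ?_) hsum
      refine (ContinuousMap.norm_le _ (abs_nonneg _)).2 fun x => ?_
      exact (hnorm k x).le
  have h1 : ∀ ω : ℝ, ∑' k, f k ω = (S ω : ℂ) * Complex.exp (Complex.I * m * ω) := fun ω => by
    rw [hS, ← tsum_mul_right]
    congr 1 with k
    simp only [f, ContinuousMap.coe_mk, mul_assoc]
    rw [← Complex.exp_add]
    congr 2
    push_cast; ring
  simp only [h1] at key
  refine key.unique ?_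
  have h2 : ∀ k, ∫ ω in (0 : ℝ)..(2 * Real.pi), f k ω =
      if k = m then ((2 * Real.pi : ℝ) : ℂ) * r m else 0 := fun k => by
    simp only [f, ContinuousMap.coe_mk]
    rw [intervalIntegral.integral_const_mul, integral_exp_I_mul_int]
    by_cases h : k = m
    · subst h; simp [mul_comm]
    · simp [h, sub_eq_zero, Ne.symm h]
  simp only [h2]
  exact hasSum_ite_eq m _

/-- The polynomial whose coefficients are the entries of `v`. -/
noncomputable def vecPoly {n : ℕ} (v : Fin n → ℝ) : Polynomial ℂ :=
  ∑ i, Polynomial.C (v i : ℂ) * Polynomial.X ^ (i : ℕ)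

lemma norm_sq_eval_vecPoly {n : ℕ} (v : Fin n → ℝ) (ω : ℝ) :
    ((‖(vecPoly v).eval (circleMap 0 1 ω)‖ ^ 2 : ℝ) : ℂ) =
      ∑ i, ∑ j, (v i * v j : ℂ) *
        Complex.exp (Complex.I * (((i : ℕ) : ℤ) - ((j : ℕ) : ℤ) : ℤ) * ω) := by
  have hconj : (starRingEnd ℂ) (circleMap 0 1 ω) = Complex.exp (-(ω * Complex.I)) := by
    simp [circleMap, ← Complex.exp_conj]
  rw [Complex.ofReal_pow, ← Complex.mul_conj', vecPoly]
  simp only [Polynomial.eval_finsetSum, Polynomial.eval_mul, Polynomial.eval_C,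
    Polynomial.eval_pow, Polynomial.eval_X, map_sum, map_mul, map_pow, Complex.conj_ofReal, hconj,
    Finset.sum_mul_sum]
  refine Finset.sum_congr rfl fun i _ => Finset.sum_congr rfl fun j _ => ?_
  simp only [circleMap, zero_add, Complex.ofReal_one, one_mul, ← Complex.exp_nat_mul]
  rw [mul_mul_mul_comm, ← Complex.exp_add]
  congr 2
  push_cast; ring

lemma integral_norm_sq_vecPoly_mul (hsum : Summable fun k => |r k|)
    (hS : ∀ ω : ℝ, (S ω : ℂ) = ∑' k : ℤ, (r k : ℂ) * Complex.exp (-Complex.I * k * ω))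
    {n : ℕ} (v : Fin n → ℝ) :
    ∫ ω in (0 : ℝ)..(2 * Real.pi), ‖(vecPoly v).eval (circleMap 0 1 ω)‖ ^ 2 * S ω =
      2 * Real.pi * (v ⬝ᵥ Matrix.of (fun i j : Fin n => r ((i.val : ℤ) - (j.val : ℤ))) *ᵥ v) := by
  have hc := continuous_of_fourier_series hsum hS
  apply Complex.ofReal_injective
  rw [← intervalIntegral.integral_ofReal]
  have h1 : ∀ ω : ℝ, ((‖(vecPoly v).eval (circleMap 0 1 ω)‖ ^ 2 * S ω : ℝ) : ℂ) =
      ∑ i, ∑ j, (v i * v j : ℂ) * ((S ω : ℂ) *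
        Complex.exp (Complex.I * (((i : ℕ) : ℤ) - ((j : ℕ) : ℤ) : ℤ) * ω)) := fun ω => by
    rw [Complex.ofReal_mul, norm_sq_eval_vecPoly, Finset.sum_mul]
    refine Finset.sum_congr rfl fun i _ => ?_
    rw [Finset.sum_mul]
    exact Finset.sum_congr rfl fun j _ => by ring
  simp only [h1]
  rw [intervalIntegral.integral_finsetSum fun i _ =>
    Continuous.intervalIntegrable (by fun_prop) _ _]
  simp only [Matrix.mulVec, dotProduct, Matrix.of_apply, Complex.ofReal_mul, Complex.ofReal_sum,
    Finset.mul_sum]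
  refine Finset.sum_congr rfl fun i _ => ?_
  rw [intervalIntegral.integral_finsetSum fun i _ =>
    Continuous.intervalIntegrable (by fun_prop) _ _]
  refine Finset.sum_congr rfl fun j _ => ?_
  rw [intervalIntegral.integral_const_mul, integral_mul_exp_of_fourier_series hsum hS]
  push_cast; ring

end SpectralDensity

/-- A lower bound for weighted `L²` norms on the circle, from Jensen's inequality and Jensen's
formula. -/
lemma exp_integral_log_le_integral_norm_sq_mul {f : ℝ → ℝ} (hf : Continuous f)
    (hpos : ∀ ω, 0 < f ω) {p : Polynomial ℂ} (hp : p.leadingCoeff = 1) :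
    Real.exp ((2 * Real.pi)⁻¹ * ∫ ω in (0 : ℝ)..(2 * Real.pi), Real.log (f ω)) ≤
      (2 * Real.pi)⁻¹ *
        ∫ ω in (0 : ℝ)..(2 * Real.pi), ‖p.eval (circleMap 0 1 ω)‖ ^ 2 * f ω := by
  have hπ := Real.two_pi_pos
  have hp0 : p ≠ 0 := by rintro rfl; simp at hp
  have hM : 0 ≤ (2 * Real.pi)⁻¹ *
      ∫ ω in (0 : ℝ)..(2 * Real.pi), Real.log ‖p.eval (circleMap 0 1 ω)‖ := by
    have := p.leadingCoeff_le_mahlerMeasure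
    rw [hp, norm_one, Polynomial.mahlerMeasure_def_of_ne_zero hp0] at this
    exact Real.one_le_exp_iff.1 this
  have hi1 := p.intervalIntegrable_mahlerMeasure
  have hi2 : IntervalIntegrable (fun ω => Real.log (f ω)) volume 0 (2 * Real.pi) :=
    (hf.log fun ω => (hpos ω).ne').intervalIntegrable _ _
  set L := (2 * Real.pi)⁻¹ * ∫ ω in (0 : ℝ)..(2 * Real.pi), Real.log (f ω) with hL
  have hcont : Continuous fun ω => ‖p.eval (circleMap 0 1 ω)‖ ^ 2 * f ω := by
    have := p.continuous
    have := continuous_circleMap 0 1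
    fun_prop
  have hle : ∫ ω in (0 : ℝ)..(2 * Real.pi),
      (2 * Real.log ‖p.eval (circleMap 0 1 ω)‖ + Real.log (f ω) - L + 1) ≤
      ∫ ω in (0 : ℝ)..(2 * Real.pi),
        Real.exp (-L) * (‖p.eval (circleMap 0 1 ω)‖ ^ 2 * f ω) := by
    refine intervalIntegral.integral_mono_ae hπ.le
      ((((hi1.const_mul 2).add hi2).sub intervalIntegrable_const).add intervalIntegrable_const)
      ((hcont.intervalIntegrable _ _).const_mul _) ?_
    have hcount : ((circleMap 0 1) ⁻¹' {z | p.eval z = 0}).Countable := by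
      refine Set.Countable.preimage_circleMap ?_ 0 one_ne_zero
      exact (p.rootSet_finite ℂ).countable.mono fun z hz => by
        simpa [Polynomial.mem_rootSet, hp0] using hz
    have hnull := measure_eq_zero_iff_ae_notMem.1 (hcount.measure_zero volume)
    filter_upwards [hnull] with ω hω
    have hz : 0 < ‖p.eval (circleMap 0 1 ω)‖ := norm_pos_iff.2 hω
    have h := Real.add_one_le_exp
      (2 * Real.log ‖p.eval (circleMap 0 1 ω)‖ + Real.log (f ω) - L)
    refine h.trans_eq ?_
    rw [sub_eq_add_neg, Real.exp_add, Real.exp_add, Real.exp_log (hpos ω), two_mul, Real.exp_add,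
      Real.exp_log hz]
    ring
  rw [intervalIntegral.integral_const_mul] at hle
  rw [intervalIntegral.integral_add
      (((hi1.const_mul 2).add hi2).sub intervalIntegrable_const) intervalIntegrable_const,
    intervalIntegral.integral_sub ((hi1.const_mul 2).add hi2) intervalIntegrable_const,
    intervalIntegral.integral_add (hi1.const_mul 2) hi2, intervalIntegral.integral_const_mul] at hle
  simp only [intervalIntegral.integral_const, sub_zero, smul_eq_mul, mul_one] at hle
  have hLint : ∫ ω in (0 : ℝ)..(2 * Real.pi), Real.log (f ω) = 2 * Real.pi * L := by
    rw [hL]; field_simp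
  rw [hLint] at hle
  have h0 : 0 ≤ ∫ ω in (0 : ℝ)..(2 * Real.pi), Real.log ‖p.eval (circleMap 0 1 ω)‖ :=
    nonneg_of_mul_nonneg_right hM (inv_pos.2 hπ)
  have h3 : 2 * Real.pi ≤ Real.exp (-L) *
      ∫ ω in (0 : ℝ)..(2 * Real.pi), ‖p.eval (circleMap 0 1 ω)‖ ^ 2 * f ω := by linarith
  rw [Real.exp_neg] at h3
  rw [le_inv_mul_iff₀ hπ]
  have hE := Real.exp_pos L
  rw [inv_mul_eq_div, le_div_iff₀ hE] at h3
  exact h3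

lemma Matrix.PosDef.exists_det_eq_prod {n : ℕ} {T : Matrix (Fin n) (Fin n) ℝ} (hT : T.PosDef) :
    ∃ W : Matrix (Fin n) (Fin n) ℝ, (∀ i, W i i = 1) ∧ (∀ i j, i < j → W i j = 0) ∧
      T.det = ∏ i, W i ⬝ᵥ T *ᵥ W i := by
  have htri : ∀ i j, i < j → LDL.lowerInv hT i j = 0 := fun i j h => LDL.lowerInv_triangular hT h
  have hdiag : ∀ i, LDL.lowerInv hT i i = 1 := fun i => by
    have h := @InnerProductSpace.gramSchmidt_def ℝ (Fin n → ℝ) _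
      (Tᵀ.toNormedAddCommGroup hT.transpose)
      (Tᵀ.toInnerProductSpace hT.transpose.posSemidef) (Fin n) _ _ _ (Pi.basisFun ℝ (Fin n)) i
    have h2 : LDL.lowerInv hT i i = _ := congrFun h i
    rw [h2, Pi.sub_apply, Finset.sum_apply, Finset.sum_eq_zero, sub_zero]
    · simp
    · intro k hk
      have hk' : LDL.lowerInv hT k i = 0 := htri k i (Finset.mem_Iio.1 hk)
      rw [Submodule.starProjection_singleton, Pi.smul_apply]
      change _ • LDL.lowerInv hT k i = 0
      rw [hk', smul_zero]
  refine ⟨LDL.lowerInv hT, hdiag, htri, ?_⟩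
  have hd := congrArg Matrix.det (LDL.diag_eq_lowerInv_conj hT)
  have h1 : (LDL.lowerInv hT).det = 1 := by
    rw [Matrix.det_of_isLowerTriangular _ fun i j h => htri i j h]
    simp [hdiag]
  rw [det_mul, det_mul, det_conjTranspose, h1, LDL.diag, det_diagonal] at hd
  simp only [star_one, one_mul, mul_one] at hd
  rw [← hd]
  refine Finset.prod_congr rfl fun i _ => ?_
  rw [LDL.diagEntries, EuclideanSpace.inner_toLp_toLp]
  simp [dotProduct_comm]

lemma leadingCoeff_vecPoly {n : ℕ} {v : Fin n → ℝ} {i : Fin n} (hi : v i = 1)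
    (hv : ∀ j, i < j → v j = 0) : (vecPoly v).leadingCoeff = 1 := by
  refine Polynomial.monic_of_natDegree_le_of_coeff_eq_one (i : ℕ) ?_ ?_
  · refine Polynomial.natDegree_sum_le_of_forall_le _ _ fun j _ => ?_
    rcases lt_or_ge i j with h | h
    · simp [hv j h]
    · exact (Polynomial.natDegree_C_mul_X_pow_le _ _).trans h
  · rw [vecPoly, Polynomial.finsetSum_coeff, Finset.sum_eq_single i]
    · simp [hi]
    · intro j _ hj
      rw [Polynomial.coeff_C_mul_X_pow, if_neg fun h => hj (Fin.ext h.symm)]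
    · simp

section Toeplitz

variable {r : ℤ → ℝ} {S : ℝ → ℝ}

/-- The `n × n` Toeplitz matrix with symbol coefficients `r`. -/
def toeplitz (r : ℤ → ℝ) (n : ℕ) : Matrix (Fin n) (Fin n) ℝ :=
  Matrix.of fun i j : Fin n => r ((i.val : ℤ) - (j.val : ℤ))

lemma toeplitz_affine (r : ℤ → ℝ) (a b : ℝ) (n : ℕ) :
    toeplitz (fun k => a * (if k = 0 then 1 else 0) + b * r k) n =
      a • (1 : Matrix (Fin n) (Fin n) ℝ) + b • toeplitz r n := by
  ext i j
  simp [toeplitz, Matrix.one_apply, sub_eq_zero, Fin.ext_iff]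

lemma summable_abs_affine (hsum : Summable fun k => |r k|) (a b : ℝ) :
    Summable fun k : ℤ => |a * (if k = 0 then 1 else 0) + b * r k| := by
  have h1 : Summable fun k : ℤ => a * (if k = 0 then (1 : ℝ) else 0) :=
    (hasSum_ite_eq (0 : ℤ) (1 : ℝ)).summable.mul_left a
  exact (h1.add (hsum.of_abs.mul_left b)).abs

lemma fourier_series_affine (hsum : Summable fun k => |r k|)
    (hS : ∀ ω : ℝ, (S ω : ℂ) = ∑' k : ℤ, (r k : ℂ) * Complex.exp (-Complex.I * k * ω))
    (a b : ℝ) (ω : ℝ) :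
    ((a + b * S ω : ℝ) : ℂ) =
      ∑' k : ℤ, ((a * (if k = 0 then 1 else 0) + b * r k : ℝ) : ℂ) *
        Complex.exp (-Complex.I * k * ω) := by
  have h1 : HasSum (fun k : ℤ => (r k : ℂ) * Complex.exp (-Complex.I * k * ω)) (S ω) := by
    rw [hS]
    refine (Summable.of_norm ?_).hasSum
    simpa [norm_exp_neg_I_mul_int_mul, -neg_mul] using hsum
  have h2 : HasSum (fun k : ℤ => if k = 0 then (a : ℂ) else 0) a := hasSum_ite_eq 0 _
  have h3 := h2.add (h1.mul_left (b : ℂ))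
  push_cast
  rw [← h3.tsum_eq]
  congr 1 with k
  by_cases hk : k = 0
  · subst hk; simp
  · simp [hk, mul_assoc]

lemma toeplitz_dotProduct_mulVec_nonneg (hsum : Summable fun k => |r k|)
    (hS : ∀ ω : ℝ, (S ω : ℂ) = ∑' k : ℤ, (r k : ℂ) * Complex.exp (-Complex.I * k * ω))
    (hnn : ∀ ω, 0 ≤ S ω) {n : ℕ} (v : Fin n → ℝ) : 0 ≤ v ⬝ᵥ toeplitz r n *ᵥ v := by
  have h := integral_norm_sq_vecPoly_mul hsum hS v
  have h0 : 0 ≤ ∫ ω in (0 : ℝ)..(2 * Real.pi),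
      ‖(vecPoly v).eval (circleMap 0 1 ω)‖ ^ 2 * S ω :=
    intervalIntegral.integral_nonneg Real.two_pi_pos.le fun ω _ => mul_nonneg (sq_nonneg _) (hnn ω)
  rw [h] at h0
  exact nonneg_of_mul_nonneg_right h0 Real.two_pi_pos

lemma toeplitz_dotProduct_mulVec_le (hsum : Summable fun k => |r k|)
    (hS : ∀ ω : ℝ, (S ω : ℂ) = ∑' k : ℤ, (r k : ℂ) * Complex.exp (-Complex.I * k * ω))
    {M : ℝ} (hM : ∀ ω, S ω ≤ M) {n : ℕ} (v : Fin n → ℝ) :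
    v ⬝ᵥ toeplitz r n *ᵥ v ≤ M * (v ⬝ᵥ v) := by
  have h := toeplitz_dotProduct_mulVec_nonneg (summable_abs_affine hsum M (-1))
    (fourier_series_affine hsum hS M (-1)) (fun ω => by linarith [hM ω]) v
  rw [toeplitz_affine, add_mulVec, smul_mulVec, smul_mulVec, one_mulVec, dotProduct_add,
    dotProduct_smul, dotProduct_smul, smul_eq_mul, smul_eq_mul] at h
  linarith

lemma toeplitz_posDef (hsymm : ∀ k, r (-k) = r k) (hsum : Summable fun k => |r k|)
    (hS : ∀ ω : ℝ, (S ω : ℂ) = ∑' k : ℤ, (r k : ℂ) * Complex.exp (-Complex.I * k * ω))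
    {δ : ℝ} (hδ : 0 < δ) (hδS : ∀ ω, δ ≤ S ω) (n : ℕ) : (toeplitz r n).PosDef := by
  refine PosDef.of_dotProduct_mulVec_pos ?_ fun v hv => ?_
  · ext i j
    simp [toeplitz, ← hsymm ((i.val : ℤ) - (j.val : ℤ))]
  · have h := toeplitz_dotProduct_mulVec_nonneg (summable_abs_affine hsum (-δ) 1)
      (fourier_series_affine hsum hS (-δ) 1) (fun ω => by linarith [hδS ω]) v
    rw [toeplitz_affine, add_mulVec, smul_mulVec, smul_mulVec, one_mulVec, dotProduct_add,
      dotProduct_smul, dotProduct_smul, smul_eq_mul, smul_eq_mul] at h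
    have hpos : 0 < v ⬝ᵥ v := by simpa using dotProduct_star_self_pos_iff.2 hv
    have := mul_pos hδ hpos
    rw [star_trivial]
    linarith

/-- The non-asymptotic lower bound in Szegő's theorem: Toeplitz determinants are bounded below by
powers of the geometric mean of the symbol. -/
lemma exp_integral_log_pow_le_det_toeplitz (hsymm : ∀ k, r (-k) = r k)
    (hsum : Summable fun k => |r k|)
    (hS : ∀ ω : ℝ, (S ω : ℂ) = ∑' k : ℤ, (r k : ℂ) * Complex.exp (-Complex.I * k * ω))
    {δ : ℝ} (hδ : 0 < δ) (hδS : ∀ ω, δ ≤ S ω) (n : ℕ) :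
    Real.exp ((2 * Real.pi)⁻¹ * ∫ ω in (0 : ℝ)..(2 * Real.pi), Real.log (S ω)) ^ n ≤
      (toeplitz r n).det := by
  obtain ⟨W, hW1, hW0, hdet⟩ := (toeplitz_posDef hsymm hsum hS hδ hδS n).exists_det_eq_prod
  rw [hdet]
  calc _ = ∏ _i : Fin n, Real.exp ((2 * Real.pi)⁻¹ *
        ∫ ω in (0 : ℝ)..(2 * Real.pi), Real.log (S ω)) := by simp
    _ ≤ _ := Finset.prod_le_prod (fun _ _ => (Real.exp_pos _).le) fun i _ => ?_
  refine (exp_integral_log_le_integral_norm_sq_mul (continuous_of_fourier_series hsum hS)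
    (fun ω => hδ.trans_le (hδS ω)) (leadingCoeff_vecPoly (hW1 i) (hW0 i))).trans_eq ?_
  rw [integral_norm_sq_vecPoly_mul hsum hS, inv_mul_cancel_left₀ Real.two_pi_pos.ne']
  rfl

end Toeplitz

section Gaussian

lemma integral_exp_mul_sq_gaussianReal {c : ℝ} :
    ∫ x, Real.exp (c * x ^ 2) ∂gaussianReal 0 1 = (√(1 - 2 * c))⁻¹ := by
  rw [integral_gaussianReal_eq_integral_smul one_ne_zero]
  have h : ∀ x : ℝ, gaussianPDFReal 0 1 x • Real.exp (c * x ^ 2) =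
      (√(2 * Real.pi))⁻¹ * Real.exp (-((1 - 2 * c) / 2) * x ^ 2) := fun x => by
    simp only [gaussianPDFReal, NNReal.coe_one, mul_one, sub_zero, smul_eq_mul, mul_assoc]
    rw [← Real.exp_add]
    congr 2
    ring
  simp only [h]
  rw [integral_const_mul, integral_gaussian, ← Real.sqrt_inv, ← Real.sqrt_inv,
    ← Real.sqrt_mul (by positivity)]
  congr 1
  have := Real.pi_pos
  field_simp

lemma integrable_exp_mul_sq_gaussianReal {c : ℝ} (hc : 2 * c < 1) :
    Integrable (fun x => Real.exp (c * x ^ 2)) (gaussianReal 0 1) := by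
  refine Integrable.of_integral_ne_zero ?_
  rw [integral_exp_mul_sq_gaussianReal]
  have : 0 < 1 - 2 * c := by linarith
  positivity

lemma map_orthonormalBasis_pi_gaussianReal {n : ℕ}
    (b : OrthonormalBasis (Fin n) ℝ (EuclideanSpace ℝ (Fin n))) :
    (Measure.pi fun _ : Fin n => gaussianReal 0 1).map
      (fun x => (∑ i, x i • b i).ofLp) = Measure.pi fun _ : Fin n => gaussianReal 0 1 := by
  have h : (Measure.pi fun _ : Fin n => gaussianReal 0 1).map (WithLp.toLp 2) =
      (Measure.pi fun _ : Fin n => gaussianReal 0 1).map (fun x => ∑ i, x i • b i) := by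
    rw [map_pi_eq_stdGaussian, stdGaussian_eq_map_pi_orthonormalBasis b]
  have h2 := congrArg (Measure.map (WithLp.ofLp (p := 2) (V := Fin n → ℝ))) h
  rw [Measure.map_map (by fun_prop) (by fun_prop), Measure.map_map (by fun_prop) (by fun_prop)]
    at h2
  exact h2.symm.trans (by exact Measure.map_id)

lemma mulVec_transpose_sq_le {n : ℕ} {A : Matrix (Fin n) (Fin n) ℝ} {M : ℝ}
    (hM : ∀ v, v ⬝ᵥ (A * Aᵀ) *ᵥ v ≤ M * (v ⬝ᵥ v)) (v : Fin n → ℝ) :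
    v ⬝ᵥ (Aᵀ * A) *ᵥ v ≤ M * (v ⬝ᵥ v) := by
  have h1 : v ⬝ᵥ (Aᵀ * A) *ᵥ v = (A *ᵥ v) ⬝ᵥ (A *ᵥ v) := by
    rw [← mulVec_mulVec, dotProduct_mulVec, vecMul_transpose]
  set w := A *ᵥ v with hw
  have h2 := hM w
  have h3 : w ⬝ᵥ (A * Aᵀ) *ᵥ w = (Aᵀ *ᵥ w) ⬝ᵥ (Aᵀ *ᵥ w) := by
    rw [← mulVec_mulVec, dotProduct_mulVec, mulVec_transpose]
  have h4 : w ⬝ᵥ w = v ⬝ᵥ (Aᵀ *ᵥ w) := by rw [← h1, hw, mulVec_mulVec]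
  have h5 : (v ⬝ᵥ (Aᵀ *ᵥ w)) ^ 2 ≤ (v ⬝ᵥ v) * ((Aᵀ *ᵥ w) ⬝ᵥ (Aᵀ *ᵥ w)) := by
    have := Finset.sum_mul_sq_le_sq_mul_sq Finset.univ v (Aᵀ *ᵥ w)
    simpa [dotProduct, sq] using this
  have hv : 0 ≤ v ⬝ᵥ v := by simpa using dotProduct_star_self_nonneg v
  have hww : 0 ≤ w ⬝ᵥ w := by simpa using dotProduct_star_self_nonneg w
  rw [h1]
  rcases hww.eq_or_lt with h | h
  · rw [← h]
    have h7 : v ⬝ᵥ (A * Aᵀ) *ᵥ v = (Aᵀ *ᵥ v) ⬝ᵥ (Aᵀ *ᵥ v) := by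
      rw [← mulVec_mulVec, dotProduct_mulVec, mulVec_transpose]
    exact le_trans (by simpa using dotProduct_star_self_nonneg (Aᵀ *ᵥ v)) (h7 ▸ hM v)
  · rw [← h4, sq] at h5
    have h6 : (v ⬝ᵥ v) * ((Aᵀ *ᵥ w) ⬝ᵥ (Aᵀ *ᵥ w)) ≤ (v ⬝ᵥ v) * (M * (w ⬝ᵥ w)) :=
      mul_le_mul_of_nonneg_left (h3 ▸ h2) hv
    refine le_of_mul_le_mul_right ?_ h
    linarith

/-- The exponential moments of a Gaussian quadratic form. -/
lemma lintegral_exp_mulVec_sq_pi_gaussianReal {n : ℕ} {A : Matrix (Fin n) (Fin n) ℝ} {M t : ℝ}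
    (hM : ∀ v, v ⬝ᵥ (A * Aᵀ) *ᵥ v ≤ M * (v ⬝ᵥ v)) (ht : 2 * t * M < 1) :
    ∫⁻ x, ENNReal.ofReal (Real.exp (t * ∑ i, (A *ᵥ x) i ^ 2))
        ∂(Measure.pi fun _ : Fin n => gaussianReal 0 1) =
      ENNReal.ofReal (√((1 - (2 * t) • (A * Aᵀ)).det))⁻¹ := by
  have hH : (Aᵀ * A).IsHermitian := by simpa using Matrix.isHermitian_conjTranspose_mul_self A
  set b := hH.eigenvectorBasis
  set l := hH.eigenvalues with hl
  have hbb : ∀ i j, (b i).ofLp ⬝ᵥ (b j).ofLp = if i = j then 1 else 0 := fun i j => by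
    have := orthonormal_iff_ite.1 b.orthonormal j i
    rw [EuclideanSpace.inner_eq_star_dotProduct] at this
    simpa [eq_comm] using this
  have hl0 : ∀ i, 0 ≤ l i ∧ l i ≤ M := fun i => by
    have h1 : (b i).ofLp ⬝ᵥ (Aᵀ * A) *ᵥ (b i).ofLp = l i := by
      rw [hH.mulVec_eigenvectorBasis, dotProduct_smul, hbb]; simp [hl]
    refine ⟨?_, ?_⟩
    · rw [← h1, ← mulVec_mulVec, dotProduct_mulVec, vecMul_transpose]
      simpa using dotProduct_star_self_nonneg (A *ᵥ (b i).ofLp)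
    · rw [← h1]
      refine (mulVec_transpose_sq_le hM _).trans_eq ?_
      simp [hbb]
  have hc : ∀ i, 2 * (t * l i) < 1 := fun i => by
    obtain ⟨h0, h1⟩ := hl0 i
    rcases le_total t 0 with h | h
    · have := mul_nonpos_of_nonpos_of_nonneg h h0
      linarith
    · have := mul_le_mul_of_nonneg_left h1 h
      linarith
  have hquad : ∀ x : Fin n → ℝ, ∑ i, (A *ᵥ (∑ i, x i • b i).ofLp) i ^ 2 =
      ∑ i, l i * x i ^ 2 := fun x => by
    have h1 : ∑ i, (A *ᵥ (∑ i, x i • b i).ofLp) i ^ 2 =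
        (∑ i, x i • b i).ofLp ⬝ᵥ (Aᵀ * A) *ᵥ (∑ i, x i • b i).ofLp := by
      rw [← mulVec_mulVec, dotProduct_mulVec, vecMul_transpose]
      simp [dotProduct, sq]
    rw [h1]
    simp only [WithLp.ofLp_sum, WithLp.ofLp_smul, mulVec_sum, mulVec_smul]
    simp only [b, hH.mulVec_eigenvectorBasis]
    simp only [sum_dotProduct, dotProduct_sum, smul_dotProduct, dotProduct_smul, smul_eq_mul]
    refine Finset.sum_congr rfl fun i _ => ?_
    rw [Finset.sum_eq_single i]
    · have := hbb i i
      simp only [b] at this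
      rw [this]; simp only [if_true, ← hl]; ring
    · intro j _ hj
      have := hbb j i
      simp only [b] at this
      rw [this]; simp [hj]
    · simp
  have hdet : (1 - (2 * t) • (A * Aᵀ)).det = ∏ i, (1 - 2 * (t * l i)) := by
    rw [← smul_mul_assoc, det_one_sub_mul_comm, mul_smul_comm]
    have hD : 1 - (2 * t) • (Aᵀ * A) = Unitary.conjStarAlgAut ℝ _ hH.eigenvectorUnitary
        (diagonal fun i => 1 - 2 * (t * l i)) := by
      conv_lhs => rw [hH.spectral_theorem]
      rw [← map_one (Unitary.conjStarAlgAut ℝ _ hH.eigenvectorUnitary), ← map_smul, ← map_sub]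
      congr 1
      ext i j
      by_cases hij : i = j
      · subst hij; simp [hl, mul_assoc]
      · simp [hij]
    rw [hD, Unitary.conjStarAlgAut_apply, det_mul_right_comm, Unitary.mul_star_self_of_mem
      hH.eigenvectorUnitary.2, one_mul, det_diagonal]
  have hmeas : Measurable fun x : Fin n → ℝ =>
      ENNReal.ofReal (Real.exp (t * ∑ i, (A *ᵥ x) i ^ 2)) := by
    simp only [mulVec, dotProduct]
    fun_prop
  rw [← map_orthonormalBasis_pi_gaussianReal b, lintegral_map hmeas (by fun_prop)]
  simp only [hquad]
  have hprod : ∀ x : Fin n → ℝ, Real.exp (t * ∑ i, l i * x i ^ 2) =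
      ∏ i, Real.exp ((t * l i) * x i ^ 2) := fun x => by
    rw [← Real.exp_sum, Finset.mul_sum]
    simp only [mul_assoc]
  simp only [hprod]
  rw [← ofReal_integral_eq_lintegral_ofReal
    (Integrable.fintype_prod fun i => integrable_exp_mul_sq_gaussianReal (hc i))
    (ae_of_all _ fun x => Finset.prod_nonneg fun i _ => (Real.exp_pos _).le),
    integral_fintype_prod_eq_prod (f := fun i (x : ℝ) => Real.exp ((t * l i) * x ^ 2))]
  simp only [integral_exp_mul_sq_gaussianReal]
  rw [hdet, Finset.prod_inv_distrib, Real.sqrt_prod]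
  exact fun i _ => by linarith [hc i]

end Gaussian

section LargeDeviations

lemma measure_le_of_lintegral_exp_le {μ : Measure ℝ} {n : ℕ} {t Λ : ℝ}
    (h : ∫⁻ z, ENNReal.ofReal (Real.exp (n * (t * z))) ∂μ ≤ ENNReal.ofReal (Real.exp (n * Λ)))
    (L : ℝ) : μ {z | L < z * t - Λ} ≤ ENNReal.ofReal (Real.exp (-(n * L))) := by
  have hsub : {z : ℝ | L < z * t - Λ} ⊆
      {z | ENNReal.ofReal (Real.exp (n * (L + Λ))) ≤
        ENNReal.ofReal (Real.exp (n * (t * z)))} := fun z hz => by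
    refine ENNReal.ofReal_le_ofReal (Real.exp_le_exp.2 ?_)
    refine mul_le_mul_of_nonneg_left ?_ n.cast_nonneg
    have : L < z * t - Λ := hz
    linarith
  have hmk := mul_meas_ge_le_lintegral (μ := μ)
    (f := fun z : ℝ => ENNReal.ofReal (Real.exp (n * (t * z)))) (by fun_prop)
    (ENNReal.ofReal (Real.exp (n * (L + Λ))))
  refine (measure_mono hsub).trans ?_
  have hpos : ENNReal.ofReal (Real.exp (n * (L + Λ))) ≠ 0 := by simp [Real.exp_pos]
  refine (ENNReal.mul_le_mul_iff_right hpos ENNReal.ofReal_ne_top).1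
    ((hmk.trans h).trans_eq ?_)
  rw [← ENNReal.ofReal_mul (Real.exp_pos _).le, ← Real.exp_add]
  congr 2
  ring

lemma limsup_log_div_le_of_le_const_mul_exp {p : ℕ → ENNReal} {K : ℕ} {L : ℝ}
    (h : ∀ n ≠ 0, p n ≤ K * ENNReal.ofReal (Real.exp (-(n * L)))) :
    limsup (fun n : ℕ => ENNReal.log (p n) / (n : EReal)) atTop ≤ ((-L : ℝ) : EReal) := by
  have hlim : Tendsto (fun n : ℕ => ((Real.log (K + 1) / n - L : ℝ) : EReal)) atTop
      (𝓝 ((-L : ℝ) : EReal)) := by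
    refine (continuous_coe_real_ereal.tendsto _).comp ?_
    have := (tendsto_const_div_atTop_nhds_zero_nat (Real.log (K + 1))).sub_const L
    simpa using this
  rw [← hlim.limsup_eq]
  refine limsup_le_limsup ?_
  filter_upwards [eventually_ne_atTop 0] with n hn
  have hn' : (0 : ℝ) < n := by exact_mod_cast Nat.pos_of_ne_zero hn
  have hK : (0 : ℝ) < K + 1 := by positivity
  have h1 : p n ≤ ENNReal.ofReal ((K + 1) * Real.exp (-(n * L))) := by
    rw [ENNReal.ofReal_mul hK.le]
    refine (h n hn).trans ?_
    gcongr
    rw [← ENNReal.ofReal_natCast]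
    exact ENNReal.ofReal_le_ofReal (by linarith)
  have h2 := ENNReal.log_le_log h1
  rw [ENNReal.log_ofReal, if_neg (not_le.2 (by positivity)),
    Real.log_mul hK.ne' (Real.exp_pos _).ne', Real.log_exp] at h2
  refine (EReal.div_le_div_right_of_nonneg (by positivity) h2).trans_eq ?_
  rw [← EReal.coe_coe_eq_natCast, ← EReal.coe_div]
  congr 1
  field_simp
  ring

/-- The exponential Chebyshev upper bound: a closed set covered by the half-lines on which some
affine function `z ↦ z t - Λ t` exceeds `L` has exponential rate at least `L`. -/
lemma limsup_log_div_le_of_lintegral_exp_le {P : ℕ → Measure ℝ} {D : Set ℝ} {Λ : ℝ → ℝ}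
    (hP : ∀ n ≠ 0, ∀ t ∈ D,
      ∫⁻ z, ENNReal.ofReal (Real.exp (n * (t * z))) ∂P n ≤ ENNReal.ofReal (Real.exp (n * Λ t)))
    (hneg : ∃ t ∈ D, t < 0) (hpos : ∃ t ∈ D, 0 < t) {C : Set ℝ} (hC : IsClosed C) {L : ℝ}
    (hL : ∀ z ∈ C, ∃ t ∈ D, L < z * t - Λ t) :
    limsup (fun n : ℕ => ENNReal.log (P n C) / (n : EReal)) atTop ≤ ((-L : ℝ) : EReal) := by
  obtain ⟨a, haD, ha⟩ := hneg
  obtain ⟨b, hbD, hb⟩ := hpos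
  let H : D → Set ℝ := fun t => {z | L < z * t - Λ t}
  have hcpt : IsCompact (C ∩ Set.Icc ((L + Λ a) / a) ((L + Λ b) / b)) := isCompact_Icc.inter_left hC
  obtain ⟨s, hs⟩ := hcpt.elim_finite_subcover H
    (fun t => isOpen_lt continuous_const (by fun_prop)) fun z hz => by
      obtain ⟨t, ht, hzt⟩ := hL z hz.1
      exact Set.mem_iUnion.2 ⟨⟨t, ht⟩, hzt⟩
  classical
  let s' : Finset D := insert ⟨a, haD⟩ (insert ⟨b, hbD⟩ s)
  have hcover : C ⊆ ⋃ t ∈ s', H t := fun z hz => by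
    rw [Set.mem_iUnion₂]
    by_cases h1 : z < (L + Λ a) / a
    · refine ⟨⟨a, haD⟩, by simp [s'], ?_⟩
      rw [lt_div_iff_of_neg ha] at h1
      change L < z * a - Λ a
      linarith
    by_cases h2 : (L + Λ b) / b < z
    · refine ⟨⟨b, hbD⟩, by simp [s'], ?_⟩
      rw [div_lt_iff₀ hb] at h2
      change L < z * b - Λ b
      linarith
    · obtain ⟨t, ht, hzt⟩ := Set.mem_iUnion₂.1 (hs ⟨hz, not_lt.1 h1, not_lt.1 h2⟩)
      exact ⟨t, by simp [s', ht], hzt⟩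
  refine limsup_log_div_le_of_le_const_mul_exp (K := s'.card) fun n hn => ?_
  calc P n C ≤ P n (⋃ t ∈ s', H t) := measure_mono hcover
    _ ≤ ∑ t ∈ s', P n (H t) := measure_biUnion_finset_le _ _
    _ ≤ ∑ _t ∈ s', ENNReal.ofReal (Real.exp (-(n * L))) :=
      Finset.sum_le_sum fun t _ => measure_le_of_lintegral_exp_le (hP n hn t t.2) L
    _ = _ := by rw [Finset.sum_const, nsmul_eq_mul]

end LargeDeviations

/-- The limiting logarithmic moment generating function bounds the normalized logarithmic moment
generating functions of the Gaussian quadratic averages for every `n`. -/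
lemma lintegral_exp_quadratic_average_le {r : ℤ → ℝ} (hsymm : ∀ k, r (-k) = r k)
    (hsum : Summable fun k => |r k|) {S : ℝ → ℝ}
    (hS : ∀ ω : ℝ, (S ω : ℂ) = ∑' k : ℤ, (r k : ℂ) * Complex.exp (-Complex.I * k * ω))
    {M : ℝ} (hbound : ∀ ω : ℝ, 0 ≤ S ω ∧ S ω ≤ M) {n : ℕ} (hn : n ≠ 0)
    {A : Matrix (Fin n) (Fin n) ℝ} (hA : A * Aᵀ = toeplitz r n) {t : ℝ} (ht : 2 * t * M < 1) :
    ∫⁻ z, ENNReal.ofReal (Real.exp (n * (t * z)))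
        ∂(Measure.map (fun x : Fin n → ℝ => (1 / (n : ℝ)) * ∑ i, (x i) ^ 2)
          (Measure.map A.mulVec (Measure.pi fun _ : Fin n => gaussianReal 0 1))) ≤
      ENNReal.ofReal (Real.exp (n * (-(1 / (4 * Real.pi)) *
        ∫ ω in (0 : ℝ)..(2 * Real.pi), Real.log (1 - 2 * t * S ω)))) := by
  have hmul : Measurable A.mulVec := by
    unfold Matrix.mulVec dotProduct
    fun_prop
  rw [lintegral_map (by fun_prop) (by fun_prop), lintegral_map (by fun_prop) hmul]
  have hn' : (n : ℝ) ≠ 0 := Nat.cast_ne_zero.2 hn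
  have hcancel : ∀ y : ℝ, (n : ℝ) * (t * (1 / (n : ℝ) * y)) = t * y := fun y => by field_simp
  simp only [hcancel]
  rw [lintegral_exp_mulVec_sq_pi_gaussianReal (M := M) (fun v => by
    rw [hA]; exact toeplitz_dotProduct_mulVec_le hsum hS (fun ω => (hbound ω).2) v) ht]
  have hlow : ∀ ω, min 1 (1 - 2 * t * M) ≤ 1 + (-(2 * t)) * S ω := fun ω => by
    obtain ⟨h0, h1⟩ := hbound ω
    rcases le_total t 0 with h | h
    · have := mul_nonpos_of_nonpos_of_nonneg h h0
      exact (min_le_left _ _).trans (by linarith)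
    · have := mul_le_mul_of_nonneg_left h1 h
      exact (min_le_right _ _).trans (by linarith)
  have hdet := exp_integral_log_pow_le_det_toeplitz
    (r := fun k => 1 * (if k = 0 then 1 else 0) + -(2 * t) * r k)
    (fun k => by simp [hsymm k]) (summable_abs_affine hsum 1 (-(2 * t)))
    (fourier_series_affine hsum hS 1 (-(2 * t)))
    (lt_min one_pos (by linarith)) hlow n
  rw [toeplitz_affine, one_smul, neg_smul, ← sub_eq_add_neg, ← hA] at hdet
  simp only [neg_mul, ← sub_eq_add_neg] at hdet
  refine ENNReal.ofReal_le_ofReal ?_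
  set J := ∫ ω in (0 : ℝ)..(2 * Real.pi), Real.log (1 - 2 * t * S ω)
  have hsq : Real.exp (n * (4 * Real.pi)⁻¹ * J) ≤ √((1 - (2 * t) • (A * Aᵀ)).det) := by
    refine Real.le_sqrt_of_sq_le (le_trans (le_of_eq ?_) hdet)
    rw [← Real.exp_nat_mul, ← Real.exp_nat_mul]
    congr 1
    have := Real.pi_ne_zero
    push_cast
    field_simp
    norm_num
  refine (inv_anti₀ (Real.exp_pos _) hsq).trans_eq ?_
  rw [← Real.exp_neg]
  congr 1
  rw [one_div]
  ring

/-- LDP upper bound for Gaussian quadratic averages, Bryc–Dembo: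
let `r : ℤ → ℝ` be a symmetric absolutely summable autocovariance sequence with spectral density
`S(ω) = ∑_{k ∈ ℤ} r(k) e^{-ikω}` satisfying `0 ≤ S ≤ M`, with each Toeplitz matrix
`Σₙ = (r(i-j))` positive semidefinite (witnessed by a factorization `Σₙ = Aₙ Aₙᵀ`, so that
`N(0, Σₙ)` is the law of `Aₙ ⬝ Z` for `Z` standard Gaussian).  Let `Pₙ` be the law of
`Zₙ = (1/n) ∑ᵢ Xᵢ²` for `Xₙ ~ N(0, Σₙ)`, let `Λ(t) = -(1/4π) ∫₀^{2π} log (1 - 2 t S(ω)) dω` for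
`t < 1/(2M)` and `I(z) = sup_{t < 1/(2M)} (z t - Λ(t))`.  Then for every closed `C ⊆ ℝ`,
`limsup (1/n) log Pₙ(C) ≤ - inf_{z ∈ C} I(z)`. -/
theorem gaussian_quadratic_ldp_upper_bound
    (r : ℤ → ℝ) (hsymm : ∀ k, r (-k) = r k) (hsum : Summable fun k => |r k|)
    (S : ℝ → ℝ)
    (hS : ∀ ω : ℝ, (S ω : ℂ) = ∑' k : ℤ, (r k : ℂ) * Complex.exp (-Complex.I * k * ω))
    (M : ℝ) (hbound : ∀ ω : ℝ, 0 ≤ S ω ∧ S ω ≤ M)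
    (A : (n : ℕ) → Matrix (Fin n) (Fin n) ℝ)
    (hA : ∀ n : ℕ, A n * (A n)ᵀ = Matrix.of fun i j : Fin n => r ((i.val : ℤ) - (j.val : ℤ)))
    (P : ℕ → Measure ℝ)
    (hP : ∀ n : ℕ, P n = Measure.map (fun x : Fin n → ℝ => (1 / (n : ℝ)) * ∑ i, (x i) ^ 2)
        (Measure.map (A n).mulVec (Measure.pi fun _ : Fin n => gaussianReal 0 1)))
    (Λ : ℝ → ℝ)
    (hΛ : ∀ t < 1 / (2 * M),
        Λ t = -(1 / (4 * Real.pi)) * ∫ ω in (0 : ℝ)..(2 * Real.pi), Real.log (1 - 2 * t * S ω))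
    (I : ℝ → EReal)
    (hI : ∀ z : ℝ, I z = ⨆ t : {t : ℝ // t < 1 / (2 * M)}, ((z * t - Λ t : ℝ) : EReal))
    (C : Set ℝ) (hC : IsClosed C) :
    limsup (fun n : ℕ => ENNReal.log (P n C) / (n : EReal)) atTop ≤ - ⨅ z : C, I z := by
  have hM0 : 0 ≤ M := (hbound 0).1.trans (hbound 0).2
  have hdom : ∀ t < 1 / (2 * M), 2 * t * M < 1 := fun t ht => by
    rcases hM0.eq_or_lt with h | h
    · simp [← h]
    · rw [lt_div_iff₀ (by positivity)] at ht
      linarith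
  refine le_of_not_gt fun hlt => ?_
  obtain ⟨q, hq1, hq2⟩ := EReal.lt_iff_exists_real_btwn.1 hlt
  refine hq2.not_ge ?_
  have hq : ((-q : ℝ) : EReal) < ⨅ z : C, I z := by
    rw [EReal.coe_neg]
    exact EReal.neg_lt_comm.1 hq1
  have hcov : ∀ z ∈ C, ∃ t ∈ {t : ℝ | 2 * t * M < 1}, -q < z * t -
      -(1 / (4 * Real.pi)) * ∫ ω in (0 : ℝ)..(2 * Real.pi), Real.log (1 - 2 * t * S ω) := by
    intro z hz
    have h := hq.trans_le (iInf_le (fun z : C => I z) ⟨z, hz⟩)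
    simp only [hI] at h
    obtain ⟨⟨t, ht⟩, hzt⟩ := lt_iSup_iff.1 h
    refine ⟨t, hdom t ht, ?_⟩
    rw [← hΛ t ht]
    exact EReal.coe_lt_coe_iff.1 hzt
  have key := limsup_log_div_le_of_lintegral_exp_le (P := P) (D := {t : ℝ | 2 * t * M < 1})
    (Λ := fun t => -(1 / (4 * Real.pi)) *
      ∫ ω in (0 : ℝ)..(2 * Real.pi), Real.log (1 - 2 * t * S ω))
    (fun n hn t ht => by
      rw [hP n]
      exact lintegral_exp_quadratic_average_le hsymm hsum hS hbound hn (hA n) ht)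
    ⟨-1, by simp only [Set.mem_ofPred_eq]; linarith, by norm_num⟩
    ⟨1 / (2 * (M + 1)), by
      rw [Set.mem_ofPred_eq]
      field_simp
      linarith, by positivity⟩ hC hcov
  rwa [neg_neg] at key
end
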